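/- Let n ≥ 1, let Ω ⊂ ℝ^n be open, let 1 ≤ p < ∞, and let f ∈ L^1_loc(Ω) with Var(f, Ω) < ∞. Then there exists a sequence {f_i}_{i=1}^∞ ⊂ W^{1,1}_loc(Ω) such that f_i − f → 0 in L^1(Ω) ∩ L^p(Ω) and ∫_Ω |∇ f_i| dx → |Df|(Ω) as i → ∞. -/

import Mathlib

open MeasureTheory Filter Topology Metric
open scoped ENNReal RealInnerProductSpace Classical

noncomputable section

/-- An open cube in `ℝⁿ` with side length `ε` and arbitrary orientation. -/
def IsCube (n : ℕ) (ε : ℝ) (Q : Set (EuclideanSpace ℝ (Fin n))) : Prop :=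
  ∃ (T : EuclideanSpace ℝ (Fin n) ≃ₗᵢ[ℝ] EuclideanSpace ℝ (Fin n))
    (x : EuclideanSpace ℝ (Fin n)),
    Q = (fun y => x + T y) '' {y : EuclideanSpace ℝ (Fin n) | ∀ i, |y i| < ε / 2}

/-- The BMO-type functional `κ_ε(f, Ω)`. -/
def kappa (n : ℕ) (ε : ℝ) (f : EuclideanSpace ℝ (Fin n) → ℝ)
    (Ω : Set (EuclideanSpace ℝ (Fin n))) : ℝ≥0∞ :=
  ENNReal.ofReal (ε ^ (n - 1)) *
    ⨆ (F : Set (Set (EuclideanSpace ℝ (Fin n))))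
      (_ : ∀ Q ∈ F, IsCube n ε Q ∧ Q ⊆ Ω) (_ : F.Pairwise Disjoint),
      ∑' Q : F, ENNReal.ofReal
        (⨍ x in (Q : Set (EuclideanSpace ℝ (Fin n))),
          |f x - ⨍ y in (Q : Set (EuclideanSpace ℝ (Fin n))), f y ∂volume| ∂volume)

/-- The divergence of a vector field on `ℝⁿ`. -/
def vdiv (n : ℕ) (Φ : EuclideanSpace ℝ (Fin n) → EuclideanSpace ℝ (Fin n))
    (x : EuclideanSpace ℝ (Fin n)) : ℝ :=
  ∑ i : Fin n, fderiv ℝ Φ x (EuclideanSpace.single i 1) i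

/-- The variation `Var(f, Ω)`. -/
def variation (n : ℕ) (f : EuclideanSpace ℝ (Fin n) → ℝ)
    (Ω : Set (EuclideanSpace ℝ (Fin n))) : ℝ≥0∞ :=
  ⨆ (Φ : EuclideanSpace ℝ (Fin n) → EuclideanSpace ℝ (Fin n))
    (_ : ContDiff ℝ 1 Φ) (_ : HasCompactSupport Φ) (_ : tsupport Φ ⊆ Ω)
    (_ : ∀ x, ‖Φ x‖ ≤ 1),
    ENNReal.ofReal (∫ x in Ω, f x * vdiv n Φ x)

/-- The approximate jump set `J_f`. -/
def jumpSet (n : ℕ) (f : EuclideanSpace ℝ (Fin n) → ℝ) : Set (EuclideanSpace ℝ (Fin n)) :=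
  {x | ∃ ν : EuclideanSpace ℝ (Fin n), ‖ν‖ = 1 ∧ ∃ a b : ℝ, a ≠ b ∧
    Tendsto (fun r : ℝ =>
        ⨍ y in {y ∈ ball x r | 0 < ⟪y - x, ν⟫}, |f y - a| ∂volume)
      (𝓝[>] 0) (𝓝 0) ∧
    Tendsto (fun r : ℝ =>
        ⨍ y in {y ∈ ball x r | ⟪y - x, ν⟫ < 0}, |f y - b| ∂volume)
      (𝓝[>] 0) (𝓝 0)}

/-- The approximate discontinuity set `S_f` (the set of non-Lebesgue points). -/
def approxDiscontSet (n : ℕ) (f : EuclideanSpace ℝ (Fin n) → ℝ) :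
    Set (EuclideanSpace ℝ (Fin n)) :=
  {x | ¬ ∃ c : ℝ,
    Tendsto (fun r : ℝ => ⨍ y in ball x r, |f y - c| ∂volume) (𝓝[>] 0) (𝓝 0)}

/-- `(μ, σ)` is the polar decomposition `Df = σ |Df|` of the gradient measure of `f` on `Ω`:
`μ` plays the role of the total variation measure `|Df|` and `σ` of the polar vector field. -/
def IsVariationPair (n : ℕ) (f : EuclideanSpace ℝ (Fin n) → ℝ)
    (Ω : Set (EuclideanSpace ℝ (Fin n))) (μ : Measure (EuclideanSpace ℝ (Fin n)))
    (σ : EuclideanSpace ℝ (Fin n) → EuclideanSpace ℝ (Fin n)) : Prop :=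
  IsFiniteMeasure μ ∧ μ Ωᶜ = 0 ∧ AEStronglyMeasurable σ μ ∧ (∀ᵐ x ∂μ, ‖σ x‖ = 1) ∧
  ∀ Φ : EuclideanSpace ℝ (Fin n) → EuclideanSpace ℝ (Fin n),
    ContDiff ℝ 1 Φ → HasCompactSupport Φ → tsupport Φ ⊆ Ω →
    ∫ x in Ω, f x * vdiv n Φ x = - ∫ x, ⟪Φ x, σ x⟫ ∂μ

/-- `|D^a f|(Ω)`, the total variation of the absolutely continuous part of `Df`,
with the convention that it is `∞` if `f` is not of bounded variation in `Ω`. -/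
def absVar (n : ℕ) (f : EuclideanSpace ℝ (Fin n) → ℝ)
    (Ω : Set (EuclideanSpace ℝ (Fin n))) : ℝ≥0∞ :=
  if h : ∃ p : Measure (EuclideanSpace ℝ (Fin n)) ×
      (EuclideanSpace ℝ (Fin n) → EuclideanSpace ℝ (Fin n)),
      IsVariationPair n f Ω p.1 p.2 then
    volume.withDensity ((h.choose.1).rnDeriv volume) Ω
  else ⊤

/-- `|D^c f|(Ω)`, the total variation of the Cantor part of `Df`,
with the convention that it is `∞` if `f` is not of bounded variation in `Ω`. -/
def cantorVar (n : ℕ) (f : EuclideanSpace ℝ (Fin n) → ℝ)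
    (Ω : Set (EuclideanSpace ℝ (Fin n))) : ℝ≥0∞ :=
  if h : ∃ p : Measure (EuclideanSpace ℝ (Fin n)) ×
      (EuclideanSpace ℝ (Fin n) → EuclideanSpace ℝ (Fin n)),
      IsVariationPair n f Ω p.1 p.2 then
    (h.choose.1.singularPart volume) (Ω \ approxDiscontSet n f)
  else ⊤

/-- `|D^j f|(Ω)`, the total variation of the jump part of `Df`,
with the convention that it is `∞` if `f` is not of bounded variation in `Ω`. -/
def jumpVar (n : ℕ) (f : EuclideanSpace ℝ (Fin n) → ℝ)
    (Ω : Set (EuclideanSpace ℝ (Fin n))) : ℝ≥0∞ :=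
  if h : ∃ p : Measure (EuclideanSpace ℝ (Fin n)) ×
      (EuclideanSpace ℝ (Fin n) → EuclideanSpace ℝ (Fin n)),
      IsVariationPair n f Ω p.1 p.2 then
    (h.choose.1.singularPart volume) (jumpSet n f ∩ Ω)
  else ⊤

/-- `g` is the weak (distributional) gradient of `u` on `Ω`. -/
def HasWeakGradientOn (n : ℕ) (u : EuclideanSpace ℝ (Fin n) → ℝ)
    (g : EuclideanSpace ℝ (Fin n) → EuclideanSpace ℝ (Fin n))
    (Ω : Set (EuclideanSpace ℝ (Fin n))) : Prop :=
  ∀ φ : EuclideanSpace ℝ (Fin n) → ℝ,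
    ContDiff ℝ 1 φ → HasCompactSupport φ → tsupport φ ⊆ Ω →
    ∀ k : Fin n,
      ∫ x in Ω, u x * fderiv ℝ φ x (EuclideanSpace.single k 1) =
        - ∫ x in Ω, φ x * g x k

/-- `f ∈ BV(Ω)`: `f` is integrable on `Ω` and has finite variation in `Ω`. -/
def IsBVOn (n : ℕ) (f : EuclideanSpace ℝ (Fin n) → ℝ)
    (Ω : Set (EuclideanSpace ℝ (Fin n))) : Prop :=
  IntegrableOn f Ω volume ∧ variation n f Ω < ⊤

/-- `f ∈ SBV(Ω)`: `f ∈ BV(Ω)` and the Cantor part of `Df` vanishes. -/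
def IsSBVOn (n : ℕ) (f : EuclideanSpace ℝ (Fin n) → ℝ)
    (Ω : Set (EuclideanSpace ℝ (Fin n))) : Prop :=
  IsBVOn n f Ω ∧ cantorVar n f Ω = 0



open scoped ContDiff Convolution

set_option linter.unusedSectionVars false

section Mollification

open ContinuousLinearMap

variable {E : Type*} [NormedAddCommGroup E] [InnerProductSpace ℝ E] [FiniteDimensional ℝ E]
  [MeasurableSpace E] [BorelSpace E]
  {F : Type*} [NormedAddCommGroup F] [NormedSpace ℝ F] [CompleteSpace F]
  {F' : Type*} [NormedAddCommGroup F'] [NormedSpace ℝ F'] [CompleteSpace F']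

/-- The bump function supported in the ball of radius `1 / (j + 1)` around the origin. -/
def mollifierBump (E : Type*) [NormedAddCommGroup E] (j : ℕ) : ContDiffBump (0 : E) where
  rIn := 1 / (2 * ((j : ℝ) + 1))
  rOut := 1 / ((j : ℝ) + 1)
  rIn_pos := by positivity
  rIn_lt_rOut := by
    apply one_div_lt_one_div_of_lt <;> linarith [Nat.cast_nonneg (α := ℝ) j]

/-- The standard mollification of `h` at scale `1 / (j + 1)`. -/
def mollify (j : ℕ) (h : E → F) : E → F :=
  (mollifierBump E j).normed volume ⋆[lsmul ℝ ℝ, volume] h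

lemma mollifierBump_rOut (j : ℕ) : (mollifierBump E j).rOut = 1 / ((j : ℝ) + 1) := rfl

lemma mollify_apply (j : ℕ) (h : E → F) (x : E) :
    mollify j h x = ∫ t, (mollifierBump E j).normed volume t • h (x - t) := rfl

lemma contDiff_mollify (j : ℕ) {h : E → F} (hh : LocallyIntegrable h) :
    ContDiff ℝ ∞ (mollify j h) :=
  (mollifierBump E j).hasCompactSupport_normed.contDiff_convolution_left _
    (mollifierBump E j).contDiff_normed hh

lemma support_mollify_subset (j : ℕ) (h : E → F) :
    Function.support (mollify j h) ⊆ thickening (1 / ((j : ℝ) + 1)) (Function.support h) := by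
  intro x hx
  obtain ⟨y, hy, z, hz, rfl⟩ := support_convolution_subset_swap _ hx
  rw [(mollifierBump E j).support_normed_eq, mollifierBump_rOut] at hz
  rw [mem_thickening_iff]
  exact ⟨y, hy, by simpa using hz⟩

lemma hasCompactSupport_mollify (j : ℕ) {h : E → F} (hh : HasCompactSupport h) :
    HasCompactSupport (mollify j h) :=
  HasCompactSupport.convolution _ (mollifierBump E j).hasCompactSupport_normed hh

lemma integrable_mollify (j : ℕ) {h : E → F} (hh : Integrable h) :
    Integrable (mollify j h) :=
  (mollifierBump E j).integrable_normed.integrable_convolution _ hh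

lemma norm_mollify_le (j : ℕ) {h : E → F} {M : ℝ} (hM : ∀ x, ‖h x‖ ≤ M) (x : E) :
    ‖mollify j h x‖ ≤ M := by
  have h1 : ‖mollify j h x‖ ≤ ∫ t, (mollifierBump E j).normed volume t * M := by
    rw [mollify_apply]
    refine norm_integral_le_of_norm_le ((mollifierBump E j).integrable_normed.mul_const M) ?_
    refine Eventually.of_forall fun t => ?_
    rw [norm_smul, Real.norm_of_nonneg ((mollifierBump E j).nonneg_normed t)]
    exact mul_le_mul_of_nonneg_left (hM _) ((mollifierBump E j).nonneg_normed t)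
  rwa [integral_mul_const, (mollifierBump E j).integral_normed, one_mul] at h1

lemma lintegral_enorm_mollify_le (j : ℕ) {h : E → F} (hh : Integrable h) :
    ∫⁻ x, ‖mollify j h x‖ₑ ≤ ∫⁻ x, ‖h x‖ₑ := by
  set η := (mollifierBump E j).normed (volume : Measure E)
  have hη : Continuous η := (mollifierBump E j).continuous_normed
  have hη1 : ∫⁻ t, ‖η t‖ₑ = 1 := by
    have := ofReal_integral_norm_eq_lintegral_enorm (mollifierBump E j).integrable_normed
      (μ := volume)
    rw [← this]
    have : ∀ t, ‖η t‖ = η t := fun t => Real.norm_of_nonneg ((mollifierBump E j).nonneg_normed t)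
    simp_rw [η] at this ⊢
    simp_rw [this, (mollifierBump E j).integral_normed, ENNReal.ofReal_one]
  calc ∫⁻ x, ‖mollify j h x‖ₑ ≤ ∫⁻ x, ∫⁻ t, ‖η t‖ₑ * ‖h (x - t)‖ₑ := by
        refine lintegral_mono fun x => ?_
        rw [mollify_apply]
        refine (enorm_integral_le_lintegral_enorm _).trans (lintegral_mono fun t => ?_)
        rw [enorm_smul]
    _ = ∫⁻ t, ∫⁻ x, ‖η t‖ₑ * ‖h (x - t)‖ₑ := by
        refine lintegral_lintegral_swap ?_
        have : AEStronglyMeasurable (fun p : E × E => η p.2 • h (p.1 - p.2))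
            (volume.prod volume) :=
          hη.aestronglyMeasurable.convolution_integrand (lsmul ℝ ℝ) hh.aestronglyMeasurable
        simpa [Function.uncurry_def, enorm_smul] using this.enorm
    _ = ∫⁻ t, ‖η t‖ₑ * ∫⁻ x, ‖h x‖ₑ := by
        refine lintegral_congr fun t => ?_
        rw [lintegral_const_mul' _ _ enorm_ne_top]
        rw [lintegral_sub_right_eq_self (fun x => ‖h x‖ₑ)]
    _ = ∫⁻ x, ‖h x‖ₑ := by
        rw [lintegral_mul_const _ (by fun_prop), hη1, one_mul]

lemma mollify_exists (j : ℕ) {h : E → F} (hh : LocallyIntegrable h) :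
    ConvolutionExists ((mollifierBump E j).normed volume) h (lsmul ℝ ℝ) volume :=
  (mollifierBump E j).hasCompactSupport_normed.convolutionExists_left _
    (mollifierBump E j).continuous_normed hh

lemma mollify_sub (j : ℕ) {h c : E → F} (hh : LocallyIntegrable h) (hc : LocallyIntegrable c) :
    mollify j (h - c) = mollify j h - mollify j c := by
  ext x
  have h1 := mollify_exists j hh x
  have h2 := mollify_exists j hc x
  simp only [mollify_apply, Pi.sub_apply, smul_sub]
  exact integral_sub h1 h2

lemma clm_mollify (j : ℕ) {h : E → F} (hh : LocallyIntegrable h) (T : F →L[ℝ] F') (x : E) :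
    T (mollify j h x) = mollify j (fun y => T (h y)) x := by
  have h1 : Integrable (fun t => (mollifierBump E j).normed volume t • h (x - t)) :=
    mollify_exists j hh x
  rw [mollify_apply, mollify_apply, ← T.integral_comp_comm h1]
  simp

lemma hasFDerivAt_mollify (j : ℕ) {φ : E → F} (hφ : ContDiff ℝ 1 φ) (hc : HasCompactSupport φ)
    (x : E) : HasFDerivAt (mollify j φ) (mollify j (fderiv ℝ φ) x) x :=
  hc.hasFDerivAt_convolution_right (lsmul ℝ ℝ)
    (mollifierBump E j).continuous_normed.locallyIntegrable hφ x

lemma tendsto_mollifierBump_rOut :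
    Tendsto (fun j => (mollifierBump E j).rOut) atTop (𝓝 0) := by
  simp_rw [mollifierBump_rOut]
  exact tendsto_one_div_add_atTop_nhds_zero_nat

lemma ae_tendsto_mollify {h : E → F} (hh : LocallyIntegrable h) :
    ∀ᵐ x, Tendsto (fun j => mollify j h x) atTop (𝓝 (h x)) := by
  refine ContDiffBump.ae_convolution_tendsto_right_of_locallyIntegrable (K := 2)
    tendsto_mollifierBump_rOut (Eventually.of_forall fun j => ?_) hh
  change 1 / ((j : ℝ) + 1) ≤ 2 * (1 / (2 * ((j : ℝ) + 1)))
  apply le_of_eq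
  field_simp

lemma tendsto_eLpNorm_mollify_sub_of_bounded {h : E → F} (hh : AEStronglyMeasurable h)
    {M : ℝ} (hM : ∀ x, ‖h x‖ ≤ M) (hc : HasCompactSupport h) {q : ℝ} (hq : 1 ≤ q) :
    Tendsto (fun j => eLpNorm (mollify j h - h) (ENNReal.ofReal q) volume) atTop (𝓝 0) := by
  have hM0 : 0 ≤ M := (norm_nonneg _).trans (hM 0)
  have hint : Integrable h := by
    rw [← integrableOn_iff_integrable_of_support_subset (subset_tsupport h)]
    exact Measure.integrableOn_of_bounded (M := M) hc.isCompact.measure_lt_top.ne hh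
      (Eventually.of_forall hM)
  have hq0 : ENNReal.ofReal q ≠ 0 := by simpa using by linarith
  simp_rw [eLpNorm_eq_lintegral_rpow_enorm_toReal hq0 ENNReal.ofReal_ne_top,
    ENNReal.toReal_ofReal (zero_le_one.trans hq)]
  have hK : IsCompact (cthickening 1 (tsupport h)) := hc.isCompact.cthickening
  have key : Tendsto (fun j => ∫⁻ x, ‖(mollify j h - h) x‖ₑ ^ q) atTop (𝓝 (∫⁻ _ : E, 0)) := by
    refine tendsto_lintegral_of_dominated_convergence'
      (fun x => (cthickening 1 (tsupport h)).indicator (fun _ => ENNReal.ofReal (2 * M) ^ q) x)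
      (fun j => ?_) (fun j => Eventually.of_forall fun x => ?_) ?_ ?_
    · exact ((integrable_mollify j hint).sub hint).aestronglyMeasurable.enorm.pow_const q
    · by_cases hx : x ∈ cthickening 1 (tsupport h)
      · simp only [Set.indicator_of_mem hx]
        gcongr
        rw [← ofReal_norm]
        refine ENNReal.ofReal_le_ofReal ?_
        have := norm_sub_le (mollify j h x) (h x)
        have := norm_mollify_le j hM x
        have := hM x
        simp only [Pi.sub_apply]
        linarith
      · have h1 : h x = 0 := by
          by_contra h0
          exact hx (self_subset_cthickening _ (subset_tsupport h h0))
        have h2 : mollify j h x = 0 := by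
          by_contra h0
          refine hx ?_
          have h3 := support_mollify_subset j h h0
          refine thickening_subset_cthickening _ _ (thickening_mono ?_ _
            (thickening_subset_of_subset _ (subset_tsupport h) h3))
          rw [div_le_one (by positivity)]
          linarith [Nat.cast_nonneg (α := ℝ) j]
        simp [h1, h2, (zero_lt_one.trans_le hq)]
    · rw [lintegral_indicator hK.isClosed.measurableSet, setLIntegral_const]
      exact (ENNReal.mul_lt_top (ENNReal.rpow_lt_top_of_nonneg (zero_le_one.trans hq)
        ENNReal.ofReal_ne_top) hK.measure_lt_top).ne
    · filter_upwards [ae_tendsto_mollify hint.locallyIntegrable] with x hx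
      have : Tendsto (fun j => ‖(mollify j h - h) x‖ₑ) atTop (𝓝 0) := by
        have h1 := (hx.sub_const (h x)).enorm
        simpa using h1
      have h2 := this.ennrpow_const q
      rwa [ENNReal.zero_rpow_of_pos (zero_lt_one.trans_le hq)] at h2
  rw [lintegral_zero] at key
  have h2 := key.ennrpow_const (1 / q)
  rwa [ENNReal.zero_rpow_of_pos (by positivity)] at h2

lemma tendsto_eLpNorm_one_mollify_sub {h : E → F} (hh : Integrable h) :
    Tendsto (fun j => eLpNorm (mollify j h - h) 1 volume) atTop (𝓝 0) := by
  rw [ENNReal.tendsto_nhds_zero]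
  intro ε hε
  have hε3 : ε / 3 ≠ 0 := by simp [hε.ne']
  obtain ⟨c, hc, hhc, hcont, hci⟩ := hh.exists_hasCompactSupport_lintegral_sub_le hε3
  obtain ⟨M, hM⟩ := hcont.bounded_above_of_compact_support hc
  have h1 := tendsto_eLpNorm_mollify_sub_of_bounded hcont.aestronglyMeasurable hM hc le_rfl
  rw [ENNReal.ofReal_one, ENNReal.tendsto_nhds_zero] at h1
  filter_upwards [h1 (ε / 3) (pos_iff_ne_zero.2 hε3)] with j hj
  have hmeas := hh.sub hci
  have e : mollify j h - h = mollify j (h - c) + ((mollify j c - c) - (h - c)) := by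
    rw [mollify_sub j hh.locallyIntegrable hci.locallyIntegrable]; abel
  have h2 : eLpNorm (h - c) 1 volume ≤ ε / 3 := by
    rw [eLpNorm_one_eq_lintegral_enorm]; exact hhc
  have h3 : eLpNorm (mollify j (h - c)) 1 volume ≤ ε / 3 := by
    rw [eLpNorm_one_eq_lintegral_enorm]
    exact (lintegral_enorm_mollify_le j hmeas).trans hhc
  rw [e]
  refine (eLpNorm_add_le (integrable_mollify j hmeas).aestronglyMeasurable
    (((integrable_mollify j hci).sub hci).sub hmeas).aestronglyMeasurable le_rfl).trans ?_
  refine (add_le_add h3 ((eLpNorm_sub_le ((integrable_mollify j hci).sub hci).aestronglyMeasurable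
    hmeas.aestronglyMeasurable le_rfl).trans (add_le_add hj h2))).trans ?_
  rw [← add_assoc, ENNReal.add_thirds]

end Mollification

section MollificationInner

open ContinuousLinearMap

variable {E : Type*} [NormedAddCommGroup E] [InnerProductSpace ℝ E] [FiniteDimensional ℝ E]
  [MeasurableSpace E] [BorelSpace E]
  {F : Type*} [NormedAddCommGroup F] [InnerProductSpace ℝ F] [CompleteSpace F]

lemma integral_inner_mollify (j : ℕ) {h ψ : E → F} (hh : Integrable h) (hψ : Continuous ψ)
    (hc : HasCompactSupport ψ) :
    ∫ x, ⟪mollify j h x, ψ x⟫ = ∫ x, ⟪h x, mollify j ψ x⟫ := by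
  set η := (mollifierBump E j).normed (volume : Measure E) with hη
  have hηc : Continuous η := (mollifierBump E j).continuous_normed
  have hηi : Integrable η := (mollifierBump E j).integrable_normed
  obtain ⟨M, hM⟩ := hψ.bounded_above_of_compact_support hc
  have hsymm : ∀ x, η (-x) = η x := (mollifierBump E j).normed_neg
  have hint : Integrable (fun p : E × E => η (p.1 - p.2) * ⟪h p.2, ψ p.1⟫)
      (volume.prod volume) := by
    have h1 : Integrable (fun p : E × E => η (p.1 - p.2) • h p.2) (volume.prod volume) :=
      hh.convolution_integrand (lsmul ℝ ℝ).flip hηi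
    have h2 : Continuous fun p : E × E => ψ p.1 := by fun_prop
    refine ((h1.norm.mul_const M).mono' (h1.aestronglyMeasurable.inner (𝕜 := ℝ)
      h2.aestronglyMeasurable) (Eventually.of_forall fun p => ?_)).congr
      (Eventually.of_forall fun p => ?_)
    · exact (norm_inner_le_norm _ _).trans
        (mul_le_mul_of_nonneg_left (hM _) (norm_nonneg _))
    · simp only [real_inner_smul_left]
  calc ∫ x, ⟪mollify j h x, ψ x⟫ = ∫ x, ∫ y, η (x - y) * ⟪h y, ψ x⟫ := by
        refine integral_congr_ae (Eventually.of_forall fun x => ?_)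
        simp only
        have h1 : mollify j h x = ∫ y, η (x - y) • h y := convolution_lsmul_swap
        have h2 : Integrable (fun y => η (x - y) • h y) :=
          (mollify_exists j hh.locallyIntegrable x).integrable_swap
        rw [h1, real_inner_comm, ← integral_inner h2]
        simp [real_inner_smul_right, real_inner_comm]
    _ = ∫ y, ∫ x, η (x - y) * ⟪h y, ψ x⟫ := integral_integral_swap hint
    _ = ∫ y, ⟪h y, mollify j ψ y⟫ := by
        refine integral_congr_ae (Eventually.of_forall fun y => ?_)
        simp only
        have h1 : mollify j ψ y = ∫ x, η (y - x) • ψ x := convolution_lsmul_swap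
        have h2 : Integrable (fun x => η (y - x) • ψ x) :=
          (mollify_exists j hψ.locallyIntegrable y).integrable_swap
        rw [h1, ← integral_inner h2]
        refine integral_congr_ae (Eventually.of_forall fun x => ?_)
        simp only [real_inner_smul_right]
        rw [← hsymm (y - x), neg_sub]

end MollificationInner

section Cutoff

variable {E : Type*} [NormedAddCommGroup E] [InnerProductSpace ℝ E] [FiniteDimensional ℝ E]

/-- A sequence of smooth cutoff functions exhausting the open set `Ω`. -/
structure IsCutoffSequence (Ω : Set E) (χ : ℕ → E → ℝ) : Prop where
  zero : χ 0 = 0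
  contDiff : ∀ k, ContDiff ℝ ∞ (χ k)
  hasCompactSupport : ∀ k, HasCompactSupport (χ k)
  tsupport_subset : ∀ k, tsupport (χ k) ⊆ Ω
  mem_Icc : ∀ k x, χ k x ∈ Set.Icc (0 : ℝ) 1
  tsupport_subset_interior : ∀ k, tsupport (χ k) ⊆ interior {x | χ (k + 1) x = 1}
  exists_subset_interior : ∀ K, IsCompact K → K ⊆ Ω → ∃ N, K ⊆ interior {x | χ N x = 1}

lemma exists_isCutoffSequence {Ω : Set E} (hΩ : IsOpen Ω) : ∃ χ, IsCutoffSequence Ω χ := by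
  let a : ℕ → ℝ≥0∞ := fun k => ((k : ℝ≥0∞) + 1)⁻¹
  have ha : ∀ k, a (k + 1) < a k := fun k => by
    simp only [a, ENNReal.inv_lt_inv]
    exact_mod_cast Nat.lt_succ_self _
  let K : ℕ → Set E := fun k => closedBall 0 (k : ℝ) ∩ {x | a k ≤ infEDist x Ωᶜ}
  let U : ℕ → Set E := fun k => ball 0 (k : ℝ) ∩ {x | a k < infEDist x Ωᶜ}
  have hKc : ∀ k, IsCompact (K k) := fun k =>
    (isCompact_closedBall _ _).inter_right (isClosed_le continuous_const continuous_infEDist)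
  have hUo : ∀ k, IsOpen (U k) := fun k =>
    isOpen_ball.inter (isOpen_lt continuous_const continuous_infEDist)
  have hUK : ∀ k, U k ⊆ K k := fun k x hx => ⟨ball_subset_closedBall hx.1, (show a k ≤ _ from le_of_lt hx.2)⟩
  have hKU : ∀ k, K k ⊆ U (k + 1) := fun k x hx =>
    ⟨closedBall_subset_ball (by push_cast; linarith) hx.1, (ha k).trans_le hx.2⟩
  have hKi : ∀ k, K k ⊆ interior (K (k + 1)) := fun k =>
    (hKU k).trans (interior_maximal (hUK _) (hUo _))
  have hKΩ : ∀ k, K k ⊆ Ω := fun k x hx => by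
    by_contra h
    have h1 : infEDist x Ωᶜ = 0 := infEDist_zero_of_mem h
    have h2 := hx.2
    simp only [Set.mem_ofPred_eq, h1, nonpos_iff_eq_zero, a, ENNReal.inv_eq_zero] at h2
    exact absurd h2 (by finiteness)
  have hUcov : Ω ⊆ ⋃ k, U k := fun x hx => by
    have h1 : infEDist x Ωᶜ ≠ 0 := by
      intro h
      have := (mem_closure_iff_infEDist_zero).2 h
      rw [hΩ.isClosed_compl.closure_eq] at this
      exact this hx
    obtain ⟨m, hm⟩ := ENNReal.exists_inv_nat_lt h1
    obtain ⟨m', hm'⟩ := exists_nat_gt ‖x‖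
    refine Set.mem_iUnion.2 ⟨max m m', ?_, ?_⟩
    · rw [mem_ball_zero_iff]
      exact hm'.trans_le (by exact_mod_cast le_max_right _ _)
    · refine lt_of_le_of_lt ?_ hm
      simp only [a]
      rw [ENNReal.inv_le_inv]
      exact_mod_cast (le_max_left m m').trans (Nat.le_succ _)
  have hUmono : Monotone U := monotone_nat_of_le_succ fun k => (hUK k).trans (hKU k)
  have hex : ∀ k, ∃ f : E → ℝ, ContDiff ℝ ∞ f ∧ (∀ᶠ x in 𝓝ˢ (K k), f x = 1) ∧
      (∀ x ∉ K (k + 1), f x = 0) ∧ ∀ x, f x ∈ Set.Icc (0 : ℝ) 1 := fun k => by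
    obtain ⟨f, h1, h2, h3⟩ := exists_contMDiffMap_one_nhds_of_subset_interior
      (n := ⊤) (modelWithCornersSelf ℝ E) (hKc k).isClosed (hKi k)
    exact ⟨f, f.contMDiff.contDiff, h1, h2, h3⟩
  choose f hf1 hf2 hf3 hf4 using hex
  have hts : ∀ k, tsupport (f k) ⊆ K (k + 1) := fun k =>
    closure_minimal (fun x hx => by
      by_contra h
      exact hx (hf3 k x h)) (hKc _).isClosed
  have hint : ∀ k, K k ⊆ interior {x | f k x = 1} := fun k =>
    subset_interior_iff_mem_nhdsSet.2 (hf2 k)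
  refine ⟨fun k => Nat.casesOn k 0 f, ⟨rfl, ?_, ?_, ?_, ?_, ?_, ?_⟩⟩
  · rintro (_ | k)
    · exact contDiff_const
    · exact hf1 k
  · rintro (_ | k)
    · exact HasCompactSupport.zero
    · exact (hKc (k + 1)).of_isClosed_subset (isClosed_tsupport _) (hts k)
  · rintro (_ | k)
    · simp [tsupport]
    · exact (hts k).trans (hKΩ _)
  · rintro (_ | k) x
    · simp
    · exact hf4 k x
  · rintro (_ | k)
    · simp [tsupport]
    · exact (hts k).trans (hint (k + 1))
  · intro L hL hLΩ
    obtain ⟨N, hN⟩ := hL.elim_directed_cover U hUo (hLΩ.trans hUcov) hUmono.directed_le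
    exact ⟨N + 1, (hN.trans (hUK N)).trans (hint N)⟩

namespace IsCutoffSequence

variable {Ω : Set E} {χ : ℕ → E → ℝ} (hχ : IsCutoffSequence Ω χ)

include hχ

lemma le_succ (k : ℕ) (x : E) : χ k x ≤ χ (k + 1) x := by
  by_cases hx : χ k x = 0
  · rw [hx]; exact (hχ.mem_Icc _ _).1
  · have h0 := interior_subset (hχ.tsupport_subset_interior k (subset_tsupport _ hx))
    have h1 : χ (k + 1) x = 1 := h0
    rw [h1]; exact (hχ.mem_Icc _ _).2

lemma interior_mono : Monotone fun k => interior {x | χ k x = 1} :=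
  monotone_nat_of_le_succ fun k => _root_.interior_mono fun x (hx : χ k x = 1) =>
    le_antisymm (hχ.mem_Icc _ _).2 (hx ▸ hχ.le_succ k x)

end IsCutoffSequence

end Cutoff

section TestFunctions

variable {E : Type*} [NormedAddCommGroup E] [InnerProductSpace ℝ E] [FiniteDimensional ℝ E]
  [MeasurableSpace E] [BorelSpace E]
  {F : Type*} [NormedAddCommGroup F] [NormedSpace ℝ F]

/-- `φ` is continuously differentiable with compact support in `Ω`. -/
structure IsTestMap (Ω : Set E) (φ : E → F) : Prop where
  contDiff : ContDiff ℝ 1 φ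
  hasCompactSupport : HasCompactSupport φ
  tsupport_subset : tsupport φ ⊆ Ω

lemma LocallyIntegrableOn.integrable_smul {Ω : Set E} {u : E → F} (hu : LocallyIntegrableOn u Ω)
    {ψ : E → ℝ} (hψ : Continuous ψ) (hc : HasCompactSupport ψ) (hs : tsupport ψ ⊆ Ω) :
    Integrable fun x => ψ x • u x := by
  have h1 : IntegrableOn u (tsupport ψ) := hu.integrableOn_compact_subset hs hc.isCompact
  have h2 := h1.continuousOn_smul hψ.continuousOn hc.isCompact
  rwa [integrableOn_iff_integrable_of_support_subset] at h2
  intro x hx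
  refine subset_tsupport ψ fun h0 => hx ?_
  simp [h0]

lemma LocallyIntegrableOn.integrable_mul {Ω : Set E} {u : E → ℝ} (hu : LocallyIntegrableOn u Ω)
    {ψ : E → ℝ} (hψ : Continuous ψ) (hc : HasCompactSupport ψ) (hs : tsupport ψ ⊆ Ω) :
    Integrable fun x => u x * ψ x := by
  simpa [mul_comm] using LocallyIntegrableOn.integrable_smul hu hψ hc hs

lemma integral_fderiv_eq_zero {w : E → ℝ} (hw : ContDiff ℝ 1 w) (hc : HasCompactSupport w)
    (v : E) : ∫ x, fderiv ℝ w x v = 0 := by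
  have h1 : Continuous fun x => fderiv ℝ w x v :=
    (hw.continuous_fderiv one_ne_zero).clm_apply continuous_const
  have h2 := h1.integrable_of_hasCompactSupport (μ := volume) (hc.fderiv_apply ℝ v)
  have h3 := integral_mul_fderiv_eq_neg_fderiv_mul_of_integrable (μ := (volume : Measure E))
    (f := fun _ : E => (1 : ℝ)) (g := w) (v := v) (by simp) (by simpa using h2)
    (by simpa using hw.continuous.integrable_of_hasCompactSupport hc) (by simp)
    (fun x _ => (hw.differentiable one_ne_zero) x)
  simpa using h3

end TestFunctions

section WeakGradient

variable {n : ℕ} {Ω : Set (EuclideanSpace ℝ (Fin n))}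

lemma gradient_apply (g : EuclideanSpace ℝ (Fin n) → ℝ) (x : EuclideanSpace ℝ (Fin n))
    (k : Fin n) : gradient g x k = fderiv ℝ g x (EuclideanSpace.single k 1) := by
  rw [← inner_gradient_left, EuclideanSpace.inner_single_right]
  simp

lemma continuousOn_gradient (hΩ : IsOpen Ω) {g : EuclideanSpace ℝ (Fin n) → ℝ}
    (hg : ContDiffOn ℝ 1 g Ω) : ContinuousOn (gradient g) Ω :=
  (InnerProductSpace.toDual ℝ _).symm.continuous.comp_continuousOn
    (hg.continuousOn_fderiv_of_isOpen hΩ le_rfl)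

lemma contDiff_mul_of_contDiffOn {E : Type*} [NormedAddCommGroup E] [NormedSpace ℝ E]
    {F : Type*} [NormedAddCommGroup F] [NormedSpace ℝ F] {Ω : Set E}
    (hΩ : IsOpen Ω) {m : WithTop ℕ∞} {ψ : E → ℝ} {g : E → F} (hψ : ContDiff ℝ m ψ)
    (hs : tsupport ψ ⊆ Ω) (hg : ContDiffOn ℝ m g Ω) : ContDiff ℝ m fun x => ψ x • g x := by
  rw [contDiff_iff_contDiffAt]
  intro x
  by_cases hx : x ∈ Ω
  · exact hψ.contDiffAt.smul (hg.contDiffAt (hΩ.mem_nhds hx))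
  · have h1 : (fun x => ψ x • g x) =ᶠ[𝓝 x] fun _ => 0 := by
      filter_upwards [(isClosed_tsupport ψ).isOpen_compl.mem_nhds fun h => hx (hs h)] with y hy
      rw [image_eq_zero_of_notMem_tsupport hy, zero_smul]
    exact contDiffAt_const.congr_of_eventuallyEq h1

lemma hasWeakGradientOn_gradient (hΩ : IsOpen Ω) {g : EuclideanSpace ℝ (Fin n) → ℝ}
    (hg : ContDiffOn ℝ 1 g Ω) : HasWeakGradientOn n g (gradient g) Ω := by
  intro φ hφ hc hs k
  set v : EuclideanSpace ℝ (Fin n) := EuclideanSpace.single k 1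
  have hw : ContDiff ℝ 1 fun x => φ x • g x := contDiff_mul_of_contDiffOn hΩ hφ hs hg
  have hwc : HasCompactSupport fun x => φ x • g x := hc.smul_right
  have h0 := integral_fderiv_eq_zero hw hwc v
  have hd : ∀ x, fderiv ℝ (fun x => φ x • g x) x v =
      g x * fderiv ℝ φ x v + φ x * gradient g x k := by
    intro x
    by_cases hx : x ∈ Ω
    · have h1 : DifferentiableAt ℝ g x :=
        (hg.contDiffAt (hΩ.mem_nhds hx)).differentiableAt one_ne_zero
      have h2 : DifferentiableAt ℝ φ x := hφ.differentiable one_ne_zero x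
      simp only [smul_eq_mul]
      rw [fderiv_fun_mul h2 h1, gradient_apply]
      simp only [add_apply, smul_apply, smul_eq_mul]
      ring
    · have hx' : x ∉ tsupport φ := fun h => hx (hs h)
      have h1 : x ∉ tsupport (fun x => φ x • g x) :=
        fun h => hx' (tsupport_smul_subset_left _ _ h)
      have h2 : fderiv ℝ (fun x => φ x • g x) x = 0 :=
        image_eq_zero_of_notMem_tsupport fun h => h1 (tsupport_fderiv_subset ℝ h)
      have h3 : fderiv ℝ φ x = 0 :=
        image_eq_zero_of_notMem_tsupport fun h => hx' (tsupport_fderiv_subset ℝ h)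
      rw [h2, h3, image_eq_zero_of_notMem_tsupport hx']
      simp
  have hdc : Continuous fun x => fderiv ℝ φ x v :=
    (hφ.continuous_fderiv one_ne_zero).clm_apply continuous_const
  have i1 : Integrable fun x => g x * fderiv ℝ φ x v :=
    LocallyIntegrableOn.integrable_mul (hg.continuousOn.locallyIntegrableOn hΩ.measurableSet)
      hdc (hc.fderiv_apply ℝ v) ((tsupport_fderiv_apply_subset ℝ v).trans hs)
  have hgk : ContinuousOn (fun x => gradient g x k) Ω :=
    (EuclideanSpace.proj (𝕜 := ℝ) k).continuous.comp_continuousOn (continuousOn_gradient hΩ hg)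
  have i2 : Integrable fun x => φ x * gradient g x k :=
    LocallyIntegrableOn.integrable_smul (hgk.locallyIntegrableOn hΩ.measurableSet)
      hφ.continuous hc hs
  simp_rw [hd] at h0
  rw [integral_add i1 i2] at h0
  rw [setIntegral_eq_integral_of_forall_compl_eq_zero,
    setIntegral_eq_integral_of_forall_compl_eq_zero]
  · linarith
  · intro x hx
    simp [image_eq_zero_of_notMem_tsupport fun h => hx (hs h)]
  · intro x hx
    have h3 : fderiv ℝ φ x = 0 :=
      image_eq_zero_of_notMem_tsupport fun h => hx (hs (tsupport_fderiv_subset ℝ h))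
    simp [h3]

lemma fderiv_coord {Φ : EuclideanSpace ℝ (Fin n) → EuclideanSpace ℝ (Fin n)}
    {x : EuclideanSpace ℝ (Fin n)} (hΦ : DifferentiableAt ℝ Φ x) (i : Fin n)
    (v : EuclideanSpace ℝ (Fin n)) :
    fderiv ℝ (fun y => Φ y i) x v = fderiv ℝ Φ x v i := by
  have h := ((EuclideanSpace.proj (𝕜 := ℝ) i).hasFDerivAt.comp x hΦ.hasFDerivAt).fderiv
  have h2 : fderiv ℝ (fun y => Φ y i) x =
    (EuclideanSpace.proj (𝕜 := ℝ) i).comp (fderiv ℝ Φ x) := h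
  rw [h2]; rfl

lemma continuous_vdiv {Φ : EuclideanSpace ℝ (Fin n) → EuclideanSpace ℝ (Fin n)}
    (hΦ : ContDiff ℝ 1 Φ) : Continuous (vdiv n Φ) := by
  refine continuous_finsetSum _ fun i _ => ?_
  exact (EuclideanSpace.proj (𝕜 := ℝ) i).continuous.comp
    ((hΦ.continuous_fderiv one_ne_zero).clm_apply continuous_const)

lemma tsupport_vdiv_subset (Φ : EuclideanSpace ℝ (Fin n) → EuclideanSpace ℝ (Fin n)) :
    tsupport (vdiv n Φ) ⊆ tsupport Φ := by
  refine closure_minimal (fun x hx => ?_) (isClosed_tsupport _)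
  refine tsupport_fderiv_subset ℝ (subset_tsupport _ fun h => hx ?_)
  simp [vdiv, h]

lemma hasCompactSupport_vdiv {Φ : EuclideanSpace ℝ (Fin n) → EuclideanSpace ℝ (Fin n)}
    (hc : HasCompactSupport Φ) : HasCompactSupport (vdiv n Φ) :=
  hc.of_isClosed_subset (isClosed_tsupport _) (tsupport_vdiv_subset Φ)

lemma IsTestMap.integrable_mul_vdiv {Φ : EuclideanSpace ℝ (Fin n) → EuclideanSpace ℝ (Fin n)}
    (hΦ : IsTestMap Ω Φ) {u : EuclideanSpace ℝ (Fin n) → ℝ} (hu : LocallyIntegrableOn u Ω) :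
    Integrable fun x => u x * vdiv n Φ x :=
  LocallyIntegrableOn.integrable_mul hu (continuous_vdiv hΦ.contDiff)
    (hasCompactSupport_vdiv hΦ.hasCompactSupport)
    ((tsupport_vdiv_subset Φ).trans hΦ.tsupport_subset)

lemma IsTestMap.coord {Φ : EuclideanSpace ℝ (Fin n) → EuclideanSpace ℝ (Fin n)}
    (hΦ : IsTestMap Ω Φ) (i : Fin n) : IsTestMap Ω fun x => Φ x i where
  contDiff := (EuclideanSpace.proj (𝕜 := ℝ) i).contDiff.comp hΦ.contDiff
  hasCompactSupport := hΦ.hasCompactSupport.comp_left (g := fun v : EuclideanSpace ℝ (Fin n) => v i) rfl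
  tsupport_subset := (tsupport_comp_subset (g := fun v : EuclideanSpace ℝ (Fin n) => v i) rfl _).trans hΦ.tsupport_subset

lemma HasWeakGradientOn.setIntegral_mul_vdiv {u : EuclideanSpace ℝ (Fin n) → ℝ}
    {G Φ : EuclideanSpace ℝ (Fin n) → EuclideanSpace ℝ (Fin n)}
    (h : HasWeakGradientOn n u G Ω) (hu : LocallyIntegrableOn u Ω)
    (hG : LocallyIntegrableOn G Ω) (hΦ : IsTestMap Ω Φ) :
    ∫ x in Ω, u x * vdiv n Φ x = - ∫ x in Ω, ⟪Φ x, G x⟫ := by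
  have e1 : ∀ x, u x * vdiv n Φ x =
      ∑ i, u x * fderiv ℝ (fun y => Φ y i) x (EuclideanSpace.single i 1) := fun x => by
    rw [vdiv, Finset.mul_sum]
    refine Finset.sum_congr rfl fun i _ => ?_
    rw [fderiv_coord (hΦ.contDiff.differentiable one_ne_zero x)]
  have e2 : ∀ x, ⟪Φ x, G x⟫ = ∑ i, Φ x i * G x i := fun x => by
    simp [PiLp.inner_apply, mul_comm]
  have hGi : ∀ i, LocallyIntegrableOn (fun x => G x i) Ω := fun i x hx => by
    obtain ⟨s, hs, hi⟩ := hG x hx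
    exact ⟨s, hs, (EuclideanSpace.proj (𝕜 := ℝ) i).integrable_comp hi⟩
  simp_rw [e1, e2]
  rw [integral_finsetSum, integral_finsetSum, ← Finset.sum_neg_distrib]
  · refine Finset.sum_congr rfl fun i _ => ?_
    exact h _ (hΦ.coord i).contDiff (hΦ.coord i).hasCompactSupport (hΦ.coord i).tsupport_subset i
  · intro i _
    exact (LocallyIntegrableOn.integrable_smul (hGi i) (hΦ.coord i).contDiff.continuous
      (hΦ.coord i).hasCompactSupport (hΦ.coord i).tsupport_subset).integrableOn
  · intro i _
    exact (LocallyIntegrableOn.integrable_mul hu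
      (((hΦ.coord i).contDiff.continuous_fderiv one_ne_zero).clm_apply continuous_const)
      ((hΦ.coord i).hasCompactSupport.fderiv_apply ℝ _)
      ((tsupport_fderiv_apply_subset ℝ _).trans (hΦ.coord i).tsupport_subset)).integrableOn

lemma HasWeakGradientOn.ofReal_setIntegral_le {u : EuclideanSpace ℝ (Fin n) → ℝ}
    {G Φ : EuclideanSpace ℝ (Fin n) → EuclideanSpace ℝ (Fin n)}
    (h : HasWeakGradientOn n u G Ω) (hu : LocallyIntegrableOn u Ω)
    (hG : LocallyIntegrableOn G Ω) (hΦ : IsTestMap Ω Φ) (hΦ1 : ∀ x, ‖Φ x‖ ≤ 1) :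
    ENNReal.ofReal (∫ x in Ω, u x * vdiv n Φ x) ≤ ∫⁻ x in Ω, ‖G x‖ₑ := by
  rw [h.setIntegral_mul_vdiv hu hG hΦ]
  refine (ENNReal.ofReal_le_ofReal (le_abs_self _)).trans ?_
  rw [abs_neg, ← Real.norm_eq_abs, ofReal_norm]
  refine (enorm_integral_le_lintegral_enorm _).trans (lintegral_mono fun x => ?_)
  rw [← ofReal_norm, ← ofReal_norm]
  refine ENNReal.ofReal_le_ofReal ((norm_inner_le_norm _ _).trans ?_)
  exact mul_le_of_le_one_left (norm_nonneg _) (hΦ1 x)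

lemma variation_le_iff {f : EuclideanSpace ℝ (Fin n) → ℝ} {C : ℝ≥0∞} :
    variation n f Ω ≤ C ↔ ∀ Φ : EuclideanSpace ℝ (Fin n) → EuclideanSpace ℝ (Fin n),
      IsTestMap Ω Φ → (∀ x, ‖Φ x‖ ≤ 1) → ENNReal.ofReal (∫ x in Ω, f x * vdiv n Φ x) ≤ C := by
  simp only [variation, iSup_le_iff]
  exact ⟨fun h Φ hΦ => h Φ hΦ.1 hΦ.2 hΦ.3, fun h Φ h1 h2 h3 => h Φ ⟨h1, h2, h3⟩⟩

lemma IsTestMap.tendsto_setIntegral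
    {Φ : EuclideanSpace ℝ (Fin n) → EuclideanSpace ℝ (Fin n)} (hΦ : IsTestMap Ω Φ)
    {f : EuclideanSpace ℝ (Fin n) → ℝ} {u : ℕ → EuclideanSpace ℝ (Fin n) → ℝ}
    (hf : LocallyIntegrableOn f Ω) (hu : ∀ j, LocallyIntegrableOn (u j) Ω)
    (hlim : Tendsto (fun j => eLpNorm (fun x => u j x - f x) 1 (volume.restrict Ω)) atTop (𝓝 0)) :
    Tendsto (fun j => ∫ x in Ω, u j x * vdiv n Φ x) atTop
      (𝓝 (∫ x in Ω, f x * vdiv n Φ x)) := by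
  obtain ⟨M, hM⟩ := (continuous_vdiv hΦ.contDiff).bounded_above_of_compact_support
    (hasCompactSupport_vdiv hΦ.hasCompactSupport)
  refine tendsto_integral_of_L1 _ (hΦ.integrable_mul_vdiv hf).integrableOn.aestronglyMeasurable
    (Eventually.of_forall fun j => (hΦ.integrable_mul_vdiv (hu j)).integrableOn) ?_
  have h1 : Tendsto (fun j => ENNReal.ofReal M *
      eLpNorm (fun x => u j x - f x) 1 (volume.restrict Ω)) atTop (𝓝 0) := by
    simpa using ENNReal.Tendsto.const_mul hlim (Or.inr ENNReal.ofReal_ne_top)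
  refine tendsto_of_tendsto_of_tendsto_of_le_of_le tendsto_const_nhds h1
    (fun _ => zero_le) fun j => ?_
  simp only [eLpNorm_one_eq_lintegral_enorm]
  rw [← lintegral_const_mul' _ _ ENNReal.ofReal_ne_top]
  refine lintegral_mono fun x => ?_
  rw [← sub_mul, enorm_mul, mul_comm]
  gcongr
  rw [← ofReal_norm]
  exact ENNReal.ofReal_le_ofReal (hM x)

lemma variation_le_liminf {f : EuclideanSpace ℝ (Fin n) → ℝ}
    {u : ℕ → EuclideanSpace ℝ (Fin n) → ℝ}
    {G : ℕ → EuclideanSpace ℝ (Fin n) → EuclideanSpace ℝ (Fin n)}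
    (hf : LocallyIntegrableOn f Ω) (hu : ∀ j, LocallyIntegrableOn (u j) Ω)
    (hG : ∀ j, LocallyIntegrableOn (G j) Ω) (h : ∀ j, HasWeakGradientOn n (u j) (G j) Ω)
    (hlim : Tendsto (fun j => eLpNorm (fun x => u j x - f x) 1 (volume.restrict Ω)) atTop (𝓝 0)) :
    variation n f Ω ≤ liminf (fun j => ∫⁻ x in Ω, ‖G j x‖ₑ) atTop := by
  refine variation_le_iff.2 fun Φ hΦ hΦ1 => ?_
  rw [← (ENNReal.tendsto_ofReal (hΦ.tendsto_setIntegral hf hu hlim)).liminf_eq]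
  exact liminf_le_liminf (Eventually.of_forall fun j =>
    (h j).ofReal_setIntegral_le (hu j) (hG j) hΦ hΦ1)

end WeakGradient

section Duality

variable {n : ℕ} {Ω : Set (EuclideanSpace ℝ (Fin n))}

/-- A smooth approximation of the normalisation map `v ↦ ‖v‖⁻¹ • v`. -/
def smoothUnit {E : Type*} [NormedAddCommGroup E] [InnerProductSpace ℝ E] (δ : ℝ) (v : E) : E :=
  (√(δ ^ 2 + ‖v‖ ^ 2))⁻¹ • v

section SmoothUnit

variable {E : Type*} [NormedAddCommGroup E] [InnerProductSpace ℝ E] {δ : ℝ}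

lemma contDiff_smoothUnit (hδ : 0 < δ) {m : WithTop ℕ∞} :
    ContDiff ℝ m (smoothUnit δ : E → E) := by
  have h0 : ∀ v : E, 0 < δ ^ 2 + ‖v‖ ^ 2 := fun v => by positivity
  refine ContDiff.smul (ContDiff.inv ?_ fun v => (Real.sqrt_pos.2 (h0 v)).ne') contDiff_id
  exact (contDiff_const.add (contDiff_norm_sq ℝ)).sqrt fun v => (h0 v).ne'

lemma norm_smoothUnit_le (hδ : 0 < δ) (v : E) : ‖smoothUnit δ v‖ ≤ 1 := by
  have h0 : 0 < √(δ ^ 2 + ‖v‖ ^ 2) := by positivity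
  rw [smoothUnit, norm_smul, norm_inv, Real.norm_of_nonneg h0.le, inv_mul_le_iff₀ h0, mul_one]
  exact Real.le_sqrt_of_sq_le (by nlinarith)

lemma norm_sub_le_inner_smoothUnit (hδ : 0 < δ) (v : E) :
    ‖v‖ - δ ≤ ⟪smoothUnit δ v, v⟫ := by
  have h0 : 0 < √(δ ^ 2 + ‖v‖ ^ 2) := by positivity
  rw [smoothUnit, real_inner_smul_left, real_inner_self_eq_norm_sq, inv_mul_eq_div,
    le_div_iff₀ h0]
  have hv := norm_nonneg v
  rcases le_total ‖v‖ δ with h | h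
  · exact (mul_nonpos_of_nonpos_of_nonneg (by linarith) h0.le).trans (by positivity)
  · have h1 : √(δ ^ 2 + ‖v‖ ^ 2) ≤ ‖v‖ + δ := Real.sqrt_le_iff.2 ⟨by linarith, by nlinarith⟩
    nlinarith [mul_le_mul_of_nonneg_left h1 (sub_nonneg.2 h)]

end SmoothUnit

lemma contDiffOn_gradient (hΩ : IsOpen Ω) {g : EuclideanSpace ℝ (Fin n) → ℝ}
    (hg : ContDiffOn ℝ 2 g Ω) : ContDiffOn ℝ 1 (gradient g) Ω := by
  rw [contDiffOn_euclidean]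
  intro i
  simp_rw [gradient_apply]
  exact (hg.fderiv_of_isOpen hΩ (by norm_num)).clm_apply contDiffOn_const

lemma lintegral_enorm_gradient_le (hΩ : IsOpen Ω) {g : EuclideanSpace ℝ (Fin n) → ℝ}
    (hg : ContDiffOn ℝ 2 g Ω) {C : ℝ}
    (hC : ∀ Φ : EuclideanSpace ℝ (Fin n) → EuclideanSpace ℝ (Fin n), IsTestMap Ω Φ →
      (∀ x, ‖Φ x‖ ≤ 1) → ∫ x in Ω, g x * vdiv n Φ x ≤ C) :
    ∫⁻ x in Ω, ‖gradient g x‖ₑ ≤ ENNReal.ofReal C := by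
  obtain ⟨χ, hχ⟩ := exists_isCutoffSequence hΩ
  have hg1 : ContDiffOn ℝ 1 g Ω := hg.of_le (by norm_num)
  have hGc := continuousOn_gradient hΩ hg1
  have hGl : LocallyIntegrableOn (gradient g) Ω := hGc.locallyIntegrableOn hΩ.measurableSet
  have hi1 : ∀ N, Integrable fun x => χ N x * ‖gradient g x‖ := fun N =>
    LocallyIntegrableOn.integrable_smul (hGc.norm.locallyIntegrableOn hΩ.measurableSet)
      (hχ.contDiff N).continuous (hχ.hasCompactSupport N) (hχ.tsupport_subset N)
  have hi2 : ∀ N, Integrable (χ N) := fun N =>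
    (hχ.contDiff N).continuous.integrable_of_hasCompactSupport (hχ.hasCompactSupport N)
  have key : ∀ N, ∀ δ : ℝ, 0 < δ →
      ∫ x in Ω, χ N x * ‖gradient g x‖ ≤ C + δ * ∫ x in Ω, χ N x := by
    intro N δ hδ
    let S : EuclideanSpace ℝ (Fin n) → EuclideanSpace ℝ (Fin n) :=
      fun x => -smoothUnit δ (gradient g x)
    have hS : ContDiffOn ℝ 1 S Ω :=
      ((contDiff_smoothUnit hδ).comp_contDiffOn (contDiffOn_gradient hΩ hg)).neg
    have hΦ : IsTestMap Ω fun x => χ N x • S x :=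
      ⟨contDiff_mul_of_contDiffOn hΩ ((hχ.contDiff N).of_le (by exact_mod_cast le_top))
        (hχ.tsupport_subset N) hS, (hχ.hasCompactSupport N).smul_right,
        (tsupport_smul_subset_left _ _).trans (hχ.tsupport_subset N)⟩
    have hΦ1 : ∀ x, ‖χ N x • S x‖ ≤ 1 := fun x => by
      rw [norm_smul, norm_neg, Real.norm_of_nonneg (hχ.mem_Icc N x).1]
      exact mul_le_one₀ (hχ.mem_Icc N x).2 (norm_nonneg _) (norm_smoothUnit_le hδ _)
    have h1 := hC _ hΦ hΦ1
    rw [(hasWeakGradientOn_gradient hΩ hg1).setIntegral_mul_vdiv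
      (hg.continuousOn.locallyIntegrableOn hΩ.measurableSet) hGl hΦ, ← integral_neg] at h1
    have hi3 : IntegrableOn (fun x => -⟪χ N x • S x, gradient g x⟫) Ω := by
      have h3 : Integrable fun x => χ N x • ⟪smoothUnit δ (gradient g x), gradient g x⟫ :=
        LocallyIntegrableOn.integrable_smul
          ((((contDiff_smoothUnit hδ (m := 0)).continuous.comp_continuousOn hGc).inner
            hGc).locallyIntegrableOn hΩ.measurableSet)
          (hχ.contDiff N).continuous (hχ.hasCompactSupport N) (hχ.tsupport_subset N)
      refine h3.integrableOn.congr_fun (fun x _ => ?_) hΩ.measurableSet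
      simp [S]
    have h2 : ∫ x in Ω, (χ N x * ‖gradient g x‖ - δ * χ N x) ≤ C := by
      refine (integral_mono ((hi1 N).integrableOn.sub ((hi2 N).integrableOn.const_mul δ)) hi3
        fun x => ?_).trans h1
      simp only [S, real_inner_smul_left, inner_neg_left]
      have := mul_le_mul_of_nonneg_left (norm_sub_le_inner_smoothUnit hδ (gradient g x))
        (hχ.mem_Icc N x).1
      simp only [Pi.sub_apply]
      linarith
    rw [integral_sub (hi1 N).integrableOn ((hi2 N).integrableOn.const_mul δ),
      integral_const_mul] at h2
    linarith
  have key2 : ∀ N, ∫ x in Ω, χ N x * ‖gradient g x‖ ≤ C := by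
    intro N
    have hpos : 0 ≤ ∫ x in Ω, χ N x := integral_nonneg fun x => (hχ.mem_Icc N x).1
    refine le_of_forall_pos_le_add fun ε hε => ?_
    refine (key N (ε / (1 + ∫ x in Ω, χ N x)) (by positivity)).trans ?_
    gcongr
    rw [div_mul_eq_mul_div, div_le_iff₀ (by positivity)]
    nlinarith
  calc ∫⁻ x in Ω, ‖gradient g x‖ₑ
      ≤ ∫⁻ x in Ω, liminf (fun N => ENNReal.ofReal (χ N x * ‖gradient g x‖)) atTop := by
        refine setLIntegral_mono' hΩ.measurableSet fun x hx => ?_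
        obtain ⟨N, hN⟩ := hχ.exists_subset_interior {x} isCompact_singleton (by simpa using hx)
        refine le_of_eq (Tendsto.liminf_eq ?_).symm
        refine tendsto_const_nhds.congr' ?_
        filter_upwards [eventually_ge_atTop N] with M hM
        have h0 := interior_subset (hχ.interior_mono hM (hN rfl))
        have h1 : χ M x = 1 := h0
        rw [h1, one_mul, ofReal_norm]
    _ ≤ liminf (fun N => ∫⁻ x in Ω, ENNReal.ofReal (χ N x * ‖gradient g x‖)) atTop :=
        lintegral_liminf_le' fun N => (hi1 N).integrableOn.aemeasurable.ennreal_ofReal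
    _ ≤ ENNReal.ofReal C := by
        refine liminf_le_of_frequently_le' (Frequently.of_forall fun N => ?_)
        rw [← ofReal_integral_eq_lintegral_ofReal (hi1 N).integrableOn
          (Eventually.of_forall fun x => mul_nonneg (hχ.mem_Icc N x).1 (norm_nonneg _))]
        exact ENNReal.ofReal_le_ofReal (key2 N)

end Duality

section DivergenceCalculus

variable {n : ℕ} {Ω : Set (EuclideanSpace ℝ (Fin n))}

/-- The trace of an endomorphism of Euclidean space, as a continuous linear map. -/
def euclideanTrace (n : ℕ) :
    (EuclideanSpace ℝ (Fin n) →L[ℝ] EuclideanSpace ℝ (Fin n)) →L[ℝ] ℝ :=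
  ∑ i : Fin n, (EuclideanSpace.proj (𝕜 := ℝ) i).comp
    (ContinuousLinearMap.apply ℝ (EuclideanSpace ℝ (Fin n)) (EuclideanSpace.single i (1 : ℝ)))

lemma euclideanTrace_apply (A : EuclideanSpace ℝ (Fin n) →L[ℝ] EuclideanSpace ℝ (Fin n)) :
    euclideanTrace n A = ∑ i : Fin n, A (EuclideanSpace.single i 1) i := by
  simp [euclideanTrace]

lemma vdiv_eq_euclideanTrace (Φ : EuclideanSpace ℝ (Fin n) → EuclideanSpace ℝ (Fin n))
    (x : EuclideanSpace ℝ (Fin n)) : vdiv n Φ x = euclideanTrace n (fderiv ℝ Φ x) := by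
  rw [euclideanTrace_apply, vdiv]

lemma vdiv_mollify (j : ℕ) {Φ : EuclideanSpace ℝ (Fin n) → EuclideanSpace ℝ (Fin n)}
    (hΦ : ContDiff ℝ 1 Φ) (hc : HasCompactSupport Φ) (x : EuclideanSpace ℝ (Fin n)) :
    vdiv n (mollify j Φ) x = mollify j (vdiv n Φ) x := by
  rw [vdiv_eq_euclideanTrace, (hasFDerivAt_mollify j hΦ hc x).fderiv,
    clm_mollify j (hΦ.continuous_fderiv one_ne_zero).locallyIntegrable]
  congr 1
  ext y
  exact (vdiv_eq_euclideanTrace Φ y).symm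

lemma vdiv_smul {ζ : EuclideanSpace ℝ (Fin n) → ℝ}
    {Φ : EuclideanSpace ℝ (Fin n) → EuclideanSpace ℝ (Fin n)} {x : EuclideanSpace ℝ (Fin n)}
    (hζ : DifferentiableAt ℝ ζ x) (hΦ : DifferentiableAt ℝ Φ x) :
    vdiv n (fun y => ζ y • Φ y) x = ζ x * vdiv n Φ x + ⟪gradient ζ x, Φ x⟫ := by
  have h1 : ⟪gradient ζ x, Φ x⟫ = ∑ i, gradient ζ x i * Φ x i := by
    rw [PiLp.inner_apply]; simp [mul_comm]
  rw [h1, vdiv, fderiv_fun_smul hζ hΦ, vdiv, Finset.mul_sum, ← Finset.sum_add_distrib]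
  refine Finset.sum_congr rfl fun i _ => ?_
  simp [gradient_apply]

lemma vdiv_sum {ι : Type*} (s : Finset ι)
    {Φ : ι → EuclideanSpace ℝ (Fin n) → EuclideanSpace ℝ (Fin n)} {x : EuclideanSpace ℝ (Fin n)}
    (hΦ : ∀ i ∈ s, DifferentiableAt ℝ (Φ i) x) :
    vdiv n (fun y => ∑ i ∈ s, Φ i y) x = ∑ i ∈ s, vdiv n (Φ i) x := by
  simp_rw [vdiv_eq_euclideanTrace]
  rw [fderiv_fun_sum hΦ, map_sum]

lemma gradient_sum {ι : Type*} (s : Finset ι)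
    {ζ : ι → EuclideanSpace ℝ (Fin n) → ℝ} {x : EuclideanSpace ℝ (Fin n)}
    (hζ : ∀ i ∈ s, DifferentiableAt ℝ (ζ i) x) :
    gradient (fun y => ∑ i ∈ s, ζ i y) x = ∑ i ∈ s, gradient (ζ i) x := by
  simp only [gradient]
  rw [fderiv_fun_sum hζ, map_sum]

lemma setIntegral_mul_vdiv_eq_integral
    {Φ : EuclideanSpace ℝ (Fin n) → EuclideanSpace ℝ (Fin n)} (hs : tsupport Φ ⊆ Ω)
    (u : EuclideanSpace ℝ (Fin n) → ℝ) :
    ∫ x in Ω, u x * vdiv n Φ x = ∫ x, u x * vdiv n Φ x := by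
  refine setIntegral_eq_integral_of_forall_compl_eq_zero fun x hx => ?_
  rw [image_eq_zero_of_notMem_tsupport fun h => hx (hs (tsupport_vdiv_subset Φ h)), mul_zero]

lemma IsTestMap.smul {ζ : EuclideanSpace ℝ (Fin n) → ℝ} (hζ : IsTestMap Ω ζ)
    {Φ : EuclideanSpace ℝ (Fin n) → EuclideanSpace ℝ (Fin n)} (hΦ : ContDiff ℝ 1 Φ) :
    IsTestMap Ω fun x => ζ x • Φ x :=
  ⟨hζ.contDiff.smul hΦ, hζ.hasCompactSupport.smul_right,
    (tsupport_smul_subset_left _ _).trans hζ.tsupport_subset⟩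

lemma IsTestMap.sum {ι : Type*} (s : Finset ι)
    {Φ : ι → EuclideanSpace ℝ (Fin n) → EuclideanSpace ℝ (Fin n)}
    (hΦ : ∀ i ∈ s, IsTestMap Ω (Φ i)) : IsTestMap Ω fun x => ∑ i ∈ s, Φ i x := by
  have h1 : tsupport (fun x => ∑ i ∈ s, Φ i x) ⊆ ⋃ i ∈ s, tsupport (Φ i) := by
    refine closure_minimal (fun x hx => ?_)
      (isClosed_biUnion_finset fun i _ => isClosed_tsupport _)
    obtain ⟨i, hi, h⟩ := Finset.exists_ne_zero_of_sum_ne_zero hx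
    exact Set.mem_biUnion hi (subset_tsupport _ h)
  refine ⟨ContDiff.sum fun i hi => (hΦ i hi).contDiff, ?_, ?_⟩
  · exact (s.isCompact_biUnion fun i hi => (hΦ i hi).hasCompactSupport.isCompact).of_isClosed_subset
      (isClosed_tsupport _) h1
  · exact h1.trans (Set.iUnion₂_subset fun i hi => (hΦ i hi).tsupport_subset)

lemma continuous_gradient {ζ : EuclideanSpace ℝ (Fin n) → ℝ} (hζ : ContDiff ℝ 1 ζ) :
    Continuous (gradient ζ) :=
  continuousOn_univ.1 (continuousOn_gradient isOpen_univ hζ.contDiffOn)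

lemma tsupport_gradient_subset (ζ : EuclideanSpace ℝ (Fin n) → ℝ) :
    tsupport (gradient ζ) ⊆ tsupport ζ := by
  refine closure_minimal (fun x hx => ?_) (isClosed_tsupport _)
  refine tsupport_fderiv_subset ℝ (subset_tsupport _ fun h => hx ?_)
  simp [gradient, h]

lemma IsTestMap.integrable_smul_gradient {ζ : EuclideanSpace ℝ (Fin n) → ℝ}
    (hζ : IsTestMap Ω ζ) {f : EuclideanSpace ℝ (Fin n) → ℝ} (hf : LocallyIntegrableOn f Ω) :
    Integrable fun x => f x • gradient ζ x := by
  have hs := (tsupport_gradient_subset ζ).trans hζ.tsupport_subset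
  have hc : HasCompactSupport (gradient ζ) :=
    hζ.hasCompactSupport.of_isClosed_subset (isClosed_tsupport _) (tsupport_gradient_subset ζ)
  have h1 : IntegrableOn f (tsupport (gradient ζ)) :=
    hf.integrableOn_compact_subset hs hc.isCompact
  have h2 := h1.smul_continuousOn (continuous_gradient hζ.contDiff).continuousOn hc.isCompact
  rwa [integrableOn_iff_integrable_of_support_subset] at h2
  intro x hx
  refine subset_tsupport _ fun h0 => hx ?_
  simp [h0]

lemma integrable_inner_of_integrable {E : Type*} [NormedAddCommGroup E] [InnerProductSpace ℝ E]
    [MeasurableSpace E] [BorelSpace E]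
    {F : Type*} [NormedAddCommGroup F] [InnerProductSpace ℝ F] {μ : Measure E}
    [SecondCountableTopologyEither E F]
    {h ψ : E → F} (hh : Integrable h μ) (hψ : Continuous ψ) {M : ℝ} (hM : ∀ x, ‖ψ x‖ ≤ M) :
    Integrable (fun x => ⟪h x, ψ x⟫) μ := by
  refine (hh.norm.mul_const M).mono (hh.aestronglyMeasurable.inner hψ.aestronglyMeasurable)
    (Eventually.of_forall fun x => ?_)
  refine (norm_inner_le_norm _ _).trans ?_
  refine le_trans ?_ (Real.le_norm_self _)
  exact mul_le_mul_of_nonneg_left (hM x) (norm_nonneg _)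

lemma integral_mollify_mul_vdiv (j : ℕ) {ζ f : EuclideanSpace ℝ (Fin n) → ℝ}
    (hζ : IsTestMap Ω ζ) (hf : LocallyIntegrableOn f Ω)
    {Φ : EuclideanSpace ℝ (Fin n) → EuclideanSpace ℝ (Fin n)} (hΦ : ContDiff ℝ 1 Φ)
    (hc : HasCompactSupport Φ) :
    ∫ x, mollify j (fun y => ζ y • f y) x * vdiv n Φ x =
      (∫ x, f x * vdiv n (fun y => ζ y • mollify j Φ y) x) -
        ∫ x, ⟪mollify j (fun y => f y • gradient ζ y) x, Φ x⟫ := by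
  have hζf : Integrable fun y => ζ y • f y :=
    LocallyIntegrableOn.integrable_smul hf hζ.contDiff.continuous hζ.hasCompactSupport
      hζ.tsupport_subset
  have hΨ : ContDiff ℝ 1 (mollify j Φ) :=
    (contDiff_mollify j hΦ.continuous.locallyIntegrable).of_le (by exact_mod_cast le_top)
  have hT := hζ.smul hΨ
  have hg := hζ.integrable_smul_gradient hf
  obtain ⟨M, hM⟩ := hΨ.continuous.bounded_above_of_compact_support (hasCompactSupport_mollify j hc)
  have e1 := integral_inner_mollify j hζf (continuous_vdiv hΦ) (hasCompactSupport_vdiv hc)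
  have e2 := integral_inner_mollify j hg hΦ.continuous hc
  rw [e2, ← integral_sub (hT.integrable_mul_vdiv hf)
    (integrable_inner_of_integrable hg hΨ.continuous hM)]
  have e3 : ∫ x, mollify j (fun y => ζ y • f y) x * vdiv n Φ x =
      ∫ x, ⟪mollify j (fun y => ζ y • f y) x, vdiv n Φ x⟫ := by
    simp [mul_comm]
  rw [e3, e1]
  refine integral_congr_ae (Eventually.of_forall fun x => ?_)
  simp only
  rw [vdiv_smul (hζ.contDiff.differentiable one_ne_zero x) (hΨ.differentiable one_ne_zero x),
    vdiv_mollify j hΦ hc, real_inner_smul_left (gradient ζ x)]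
  simp only [smul_eq_mul, RCLike.inner_apply, conj_trivial]
  ring

lemma integral_sum_mollify_mul_vdiv_le {f : EuclideanSpace ℝ (Fin n) → ℝ}
    (hf : LocallyIntegrableOn f Ω) (hV : variation n f Ω < ⊤) {ζ : ℕ → EuclideanSpace ℝ (Fin n) → ℝ}
    (hζ : ∀ k, IsTestMap Ω (ζ k)) (hζ0 : ∀ k x, 0 ≤ ζ k x) {M : ℕ}
    (hζ1 : ∀ x, ∑ k ∈ Finset.range M, ζ k x ≤ 1) {j : ℕ → ℕ} {e : ℕ → ℝ} (he : ∀ k, 0 ≤ e k)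
    (hj : ∀ k, eLpNorm (mollify (j k) (fun y => f y • gradient (ζ k) y) -
      fun y => f y • gradient (ζ k) y) 1 volume ≤ ENNReal.ofReal (e k))
    {Φ : EuclideanSpace ℝ (Fin n) → EuclideanSpace ℝ (Fin n)} (hΦ : ContDiff ℝ 1 Φ)
    (hc : HasCompactSupport Φ) (hΦ1 : ∀ x, ‖Φ x‖ ≤ 1)
    (hgrad : ∀ x ∈ tsupport Φ, ∑ k ∈ Finset.range M, gradient (ζ k) x = 0) :
    ∫ x, (∑ k ∈ Finset.range M, mollify (j k) (fun y => ζ k y • f y) x) * vdiv n Φ x ≤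
      (variation n f Ω).toReal + ∑ k ∈ Finset.range M, e k := by
  have hΨ : ∀ k, ContDiff ℝ 1 (mollify (j k) Φ) := fun k =>
    (contDiff_mollify _ hΦ.continuous.locallyIntegrable).of_le (by exact_mod_cast le_top)
  have hg := fun k => (hζ k).integrable_smul_gradient hf
  have hi1 : ∀ k, Integrable fun x => mollify (j k) (fun y => ζ k y • f y) x * vdiv n Φ x := by
    intro k
    have h1 : Integrable fun y => ζ k y • f y :=
      LocallyIntegrableOn.integrable_smul hf (hζ k).contDiff.continuous (hζ k).hasCompactSupport
        (hζ k).tsupport_subset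
    exact LocallyIntegrableOn.integrable_mul
      ((integrable_mollify (j k) h1).locallyIntegrable.locallyIntegrableOn Set.univ)
      (continuous_vdiv hΦ) (hasCompactSupport_vdiv hc) (Set.subset_univ _)
  have hT : IsTestMap Ω fun x => ∑ k ∈ Finset.range M, ζ k x • mollify (j k) Φ x :=
    IsTestMap.sum _ fun k _ => (hζ k).smul (hΨ k)
  have hT1 : ∀ x, ‖∑ k ∈ Finset.range M, ζ k x • mollify (j k) Φ x‖ ≤ 1 := fun x => by
    refine (norm_sum_le _ _).trans (le_trans (Finset.sum_le_sum fun k _ => ?_) (hζ1 x))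
    rw [norm_smul, Real.norm_of_nonneg (hζ0 k x)]
    exact mul_le_of_le_one_right (hζ0 k x) (norm_mollify_le _ hΦ1 x)
  have hTV : ∫ x, f x * vdiv n (fun x => ∑ k ∈ Finset.range M, ζ k x • mollify (j k) Φ x) x ≤
      (variation n f Ω).toReal := by
    rw [← setIntegral_mul_vdiv_eq_integral hT.tsupport_subset]
    exact (ENNReal.ofReal_le_iff_le_toReal hV.ne).1 (variation_le_iff.1 le_rfl _ hT hT1)
  have hTsum : ∫ x, f x * vdiv n (fun x => ∑ k ∈ Finset.range M, ζ k x • mollify (j k) Φ x) x =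
      ∑ k ∈ Finset.range M, ∫ x, f x * vdiv n (fun y => ζ k y • mollify (j k) Φ y) x := by
    rw [← integral_finsetSum _ fun k _ => ((hζ k).smul (hΨ k)).integrable_mul_vdiv hf]
    refine integral_congr_ae (Eventually.of_forall fun x => ?_)
    simp only
    rw [vdiv_sum _ fun k _ => ((hζ k).smul (hΨ k)).contDiff.differentiable one_ne_zero x,
      Finset.mul_sum]
  have hzero : ∑ k ∈ Finset.range M, ∫ x, ⟪f x • gradient (ζ k) x, Φ x⟫ = 0 := by
    rw [← integral_finsetSum _ fun k _ => integrable_inner_of_integrable (hg k) hΦ.continuous hΦ1]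
    refine integral_eq_zero_of_ae (Eventually.of_forall fun x => ?_)
    simp only [Pi.zero_apply]
    rw [← sum_inner, ← Finset.smul_sum]
    by_cases hx : x ∈ tsupport Φ
    · rw [hgrad x hx]; simp
    · rw [image_eq_zero_of_notMem_tsupport hx]; simp
  have herr : ∀ k, -∫ x, ⟪mollify (j k) (fun y => f y • gradient (ζ k) y) x, Φ x⟫ ≤
      e k - ∫ x, ⟪f x • gradient (ζ k) x, Φ x⟫ := by
    intro k
    have hm := integrable_mollify (j k) (hg k)
    have h1 : (∫ x, ⟪f x • gradient (ζ k) x, Φ x⟫) -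
        ∫ x, ⟪mollify (j k) (fun y => f y • gradient (ζ k) y) x, Φ x⟫ ≤ e k := by
      rw [← integral_sub (integrable_inner_of_integrable (hg k) hΦ.continuous hΦ1)
        (integrable_inner_of_integrable hm hΦ.continuous hΦ1)]
      refine (le_abs_self _).trans ?_
      rw [← Real.norm_eq_abs, ← ENNReal.ofReal_le_ofReal_iff (he k), ofReal_norm]
      refine (enorm_integral_le_lintegral_enorm _).trans (le_trans ?_ (hj k))
      rw [eLpNorm_one_eq_lintegral_enorm]
      refine lintegral_mono fun x => ?_
      rw [← inner_sub_left, ← ofReal_norm, ← ofReal_norm]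
      refine ENNReal.ofReal_le_ofReal ((norm_inner_le_norm _ _).trans ?_)
      rw [Pi.sub_apply, norm_sub_rev]
      exact mul_le_of_le_one_right (norm_nonneg _) (hΦ1 x)
    linarith
  calc ∫ x, (∑ k ∈ Finset.range M, mollify (j k) (fun y => ζ k y • f y) x) * vdiv n Φ x
      = ∑ k ∈ Finset.range M, ∫ x, mollify (j k) (fun y => ζ k y • f y) x * vdiv n Φ x := by
        rw [← integral_finsetSum _ fun k _ => hi1 k]
        simp_rw [Finset.sum_mul]
    _ ≤ ∑ k ∈ Finset.range M, ((∫ x, f x * vdiv n (fun y => ζ k y • mollify (j k) Φ y) x) +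
          e k - ∫ x, ⟪f x • gradient (ζ k) x, Φ x⟫) := by
        refine Finset.sum_le_sum fun k _ => ?_
        rw [integral_mollify_mul_vdiv _ (hζ k) hf hΦ hc]
        linarith [herr k]
    _ = (∫ x, f x * vdiv n (fun x => ∑ k ∈ Finset.range M, ζ k x • mollify (j k) Φ x) x) +
          ∑ k ∈ Finset.range M, e k := by
        rw [Finset.sum_sub_distrib, Finset.sum_add_distrib, hzero, hTsum, sub_zero]
    _ ≤ _ := by gcongr

end DivergenceCalculus

section SmoothApproximation

lemma eLpNorm_le_tsum_of_tendsto {α F : Type*} [MeasurableSpace α] [NormedAddCommGroup F]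
    {μ : Measure α} {h : ℕ → α → F} {H : α → F} (hm : ∀ k, AEStronglyMeasurable (h k) μ)
    (hlim : ∀ᵐ x ∂μ, Tendsto (fun N => ∑ k ∈ Finset.range N, h k x) atTop (𝓝 (H x)))
    {p : ℝ≥0∞} (hp : 1 ≤ p) : eLpNorm H p μ ≤ ∑' k, eLpNorm (h k) p μ := by
  refine (Lp.eLpNorm_lim_le_liminf_eLpNorm
    (f := fun N x => ∑ k ∈ Finset.range N, h k x) (fun N => ?_) H hlim).trans ?_
  · exact Finset.aestronglyMeasurable_fun_sum _ fun k _ => hm k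
  · refine liminf_le_of_frequently_le' (Frequently.of_forall fun N => ?_)
    refine le_trans ?_ (ENNReal.sum_le_tsum (Finset.range N))
    have h1 := eLpNorm_sum_le (f := h) (s := Finset.range N) (fun k _ => hm k) hp
    rwa [Finset.sum_fn] at h1

section Layer

variable {E : Type*} [NormedAddCommGroup E] [InnerProductSpace ℝ E] [FiniteDimensional ℝ E]
  {Ω : Set E} {χ : ℕ → E → ℝ}

/-- The difference of two consecutive cutoff functions. -/
def layer (χ : ℕ → E → ℝ) (k : ℕ) (x : E) : ℝ := χ (k + 1) x - χ k x

namespace IsCutoffSequence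

variable (hχ : IsCutoffSequence Ω χ)

include hχ

lemma layer_nonneg (k : ℕ) (x : E) : 0 ≤ layer χ k x := sub_nonneg.2 (hχ.le_succ k x)

lemma sum_layer (M : ℕ) (x : E) : ∑ k ∈ Finset.range M, layer χ k x = χ M x := by
  simp [layer, Finset.sum_range_sub (fun k => χ k x), hχ.zero]

lemma eq_one_of_mem_interior {N M : ℕ} (hNM : N ≤ M) {x : E}
    (hx : x ∈ interior {x | χ N x = 1}) : χ M x = 1 := by
  have h := interior_subset (hχ.interior_mono hNM hx)
  exact h

lemma support_layer_subset (k : ℕ) : Function.support (layer χ k) ⊆ tsupport (χ (k + 1)) := by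
  intro x hx
  refine subset_tsupport _ fun h => hx ?_
  have h1 := hχ.le_succ k x
  have h2 := (hχ.mem_Icc k x).1
  rw [layer]
  linarith

lemma isTestMap_layer (k : ℕ) : IsTestMap Ω (layer χ k) := by
  have h1 : tsupport (layer χ k) ⊆ tsupport (χ (k + 1)) :=
    closure_minimal (hχ.support_layer_subset k) (isClosed_tsupport _)
  refine ⟨((hχ.contDiff (k + 1)).sub (hχ.contDiff k)).of_le (by exact_mod_cast le_top), ?_,
    h1.trans (hχ.tsupport_subset _)⟩
  exact (hχ.hasCompactSupport (k + 1)).of_isClosed_subset (isClosed_tsupport _) h1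

lemma tsupport_layer_subset (k : ℕ) : tsupport (layer χ k) ⊆ Ω \ tsupport (χ (k - 1)) := by
  refine fun x hx => ⟨(hχ.isTestMap_layer k).tsupport_subset hx, fun h => ?_⟩
  rcases k with _ | k
  · simp [hχ.zero, tsupport] at h
  · have h1 : tsupport (layer χ (k + 1)) ⊆ (interior {x | χ (k + 1) x = 1})ᶜ := by
      refine closure_minimal (fun y hy hy' => hy ?_) isOpen_interior.isClosed_compl
      rw [layer, hχ.eq_one_of_mem_interior le_rfl hy',
        hχ.eq_one_of_mem_interior (Nat.le_succ _) hy', sub_self]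
    exact h1 hx (hχ.tsupport_subset_interior k h)

end IsCutoffSequence

end Layer

variable {n : ℕ} {Ω : Set (EuclideanSpace ℝ (Fin n))}

lemma exists_layer_scales (hΩ : IsOpen Ω) {χ : ℕ → EuclideanSpace ℝ (Fin n) → ℝ}
    (hχ : IsCutoffSequence Ω χ) {f : EuclideanSpace ℝ (Fin n) → ℝ}
    (hf : LocallyIntegrableOn f Ω) {q : ℝ} (hq : 1 ≤ q)
    (hb : q = 1 ∨ ∃ M, ∀ x, |f x| ≤ M) {e : ℕ → ℝ} (he : ∀ k, 0 < e k) :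
    ∃ j : ℕ → ℕ, ∀ k,
      thickening (1 / ((j k : ℝ) + 1)) (tsupport (layer χ k)) ⊆ Ω \ tsupport (χ (k - 1)) ∧
      eLpNorm (mollify (j k) (fun y => layer χ k y • f y) - fun y => layer χ k y • f y) 1 volume ≤
        ENNReal.ofReal (e k) ∧
      eLpNorm (mollify (j k) (fun y => layer χ k y • f y) - fun y => layer χ k y • f y)
        (ENNReal.ofReal q) volume ≤ ENNReal.ofReal (e k) ∧
      eLpNorm (mollify (j k) (fun y => f y • gradient (layer χ k) y) -
        fun y => f y • gradient (layer χ k) y) 1 volume ≤ ENNReal.ofReal (e k) := by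
  have hpos : ∀ k, 0 < ENNReal.ofReal (e k) := fun k => ENNReal.ofReal_pos.2 (he k)
  suffices h : ∀ k, ∃ j : ℕ,
      thickening (1 / ((j : ℝ) + 1)) (tsupport (layer χ k)) ⊆ Ω \ tsupport (χ (k - 1)) ∧
      eLpNorm (mollify j (fun y => layer χ k y • f y) - fun y => layer χ k y • f y) 1 volume ≤
        ENNReal.ofReal (e k) ∧
      eLpNorm (mollify j (fun y => layer χ k y • f y) - fun y => layer χ k y • f y)
        (ENNReal.ofReal q) volume ≤ ENNReal.ofReal (e k) ∧
      eLpNorm (mollify j (fun y => f y • gradient (layer χ k) y) -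
        fun y => f y • gradient (layer χ k) y) 1 volume ≤ ENNReal.ofReal (e k) from
    ⟨fun k => (h k).choose, fun k => (h k).choose_spec⟩
  intro k
  have hζ := hχ.isTestMap_layer k
  have hi : Integrable fun y => layer χ k y • f y :=
    LocallyIntegrableOn.integrable_smul hf hζ.contDiff.continuous hζ.hasCompactSupport
      hζ.tsupport_subset
  obtain ⟨δ, hδ, hsub⟩ := hζ.hasCompactSupport.isCompact.exists_thickening_subset_open
    (hΩ.sdiff (isClosed_tsupport _)) (hχ.tsupport_layer_subset k)
  have h1 : ∀ᶠ j : ℕ in atTop, 1 / ((j : ℝ) + 1) < δ :=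
    tendsto_one_div_add_atTop_nhds_zero_nat.eventually_lt_const hδ
  have h2 := (tendsto_eLpNorm_one_mollify_sub hi).eventually_le_const (hpos k)
  have h4 := (tendsto_eLpNorm_one_mollify_sub
    (hζ.integrable_smul_gradient hf)).eventually_le_const (hpos k)
  have h3 : ∀ᶠ j in atTop, eLpNorm (mollify j (fun y => layer χ k y • f y) -
      fun y => layer χ k y • f y) (ENNReal.ofReal q) volume ≤ ENNReal.ofReal (e k) := by
    rcases hb with rfl | ⟨M, hM⟩
    · simpa using h2
    · refine (tendsto_eLpNorm_mollify_sub_of_bounded hi.aestronglyMeasurable (M := M) (fun x => ?_)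
        hζ.hasCompactSupport.smul_right hq).eventually_le_const (hpos k)
      rw [norm_smul, Real.norm_of_nonneg (hχ.layer_nonneg k x)]
      have h5 : layer χ k x ≤ 1 := by
        have := (hχ.mem_Icc (k + 1) x).2
        have := (hχ.mem_Icc k x).1
        rw [layer]; linarith
      exact (mul_le_of_le_one_left (norm_nonneg _) h5).trans (hM x)
  obtain ⟨j, h1, h2, h3, h4⟩ := (h1.and (h2.and (h3.and h4))).exists
  exact ⟨j, (thickening_mono h1.le _).trans hsub, h2, h3, h4⟩

lemma exists_smooth_approx (hΩ : IsOpen Ω) {f : EuclideanSpace ℝ (Fin n) → ℝ}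
    (hf : LocallyIntegrableOn f Ω) (hV : variation n f Ω < ⊤) {q : ℝ} (hq : 1 ≤ q)
    (hb : q = 1 ∨ ∃ M, ∀ x, |f x| ≤ M) {ε : ℝ} (hε : 0 < ε) :
    ∃ g : EuclideanSpace ℝ (Fin n) → ℝ, ContDiffOn ℝ 2 g Ω ∧
      eLpNorm (fun x => g x - f x) 1 (volume.restrict Ω) ≤ ENNReal.ofReal ε ∧
      eLpNorm (fun x => g x - f x) (ENNReal.ofReal q) (volume.restrict Ω) ≤ ENNReal.ofReal ε ∧
      ∫⁻ x in Ω, ‖gradient g x‖ₑ ≤ variation n f Ω + ENNReal.ofReal ε := by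
  obtain ⟨χ, hχ⟩ := exists_isCutoffSequence hΩ
  set e : ℕ → ℝ := fun k => ε / 2 / 2 ^ k with he_def
  have he : ∀ k, 0 < e k := fun k => by positivity
  have hsum : HasSum e ε := hasSum_geometric_two' ε
  have hesum : ∑' k, ENNReal.ofReal (e k) = ENNReal.ofReal ε := by
    rw [← ENNReal.ofReal_tsum_of_nonneg (fun k => (he k).le) hsum.summable, hsum.tsum_eq]
  obtain ⟨j, hj⟩ := exists_layer_scales hΩ hχ hf hq hb he
  have hζ := hχ.isTestMap_layer
  have hi : ∀ k, Integrable fun y => layer χ k y • f y := fun k =>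
    LocallyIntegrableOn.integrable_smul hf (hζ k).contDiff.continuous (hζ k).hasCompactSupport
      (hζ k).tsupport_subset
  set G : ℕ → EuclideanSpace ℝ (Fin n) → ℝ :=
    fun k => mollify (j k) (fun y => layer χ k y • f y) with hG
  have hGs : ∀ k, ContDiff ℝ ∞ (G k) := fun k => contDiff_mollify _ (hi k).locallyIntegrable
  have hG0 : ∀ N x, x ∈ interior {x | χ N x = 1} → ∀ k, N + 1 ≤ k → G k x = 0 := by
    intro N x hx k hk
    by_contra h0
    have h1 := support_mollify_subset _ _ (Function.mem_support.2 h0)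
    have h2 : Function.support (fun y => layer χ k y • f y) ⊆ tsupport (layer χ k) :=
      (Function.support_smul_subset_left (layer χ k) f).trans (subset_tsupport _)
    have h3 := (hj k).1 (thickening_subset_of_subset _ h2 h1)
    refine h3.2 (subset_tsupport _ ?_)
    rw [Function.mem_support, hχ.eq_one_of_mem_interior (by omega) hx]
    exact one_ne_zero
  set g : EuclideanSpace ℝ (Fin n) → ℝ := fun x => ∑' k, G k x with hg
  have hgeq : ∀ N x, x ∈ interior {x | χ N x = 1} → ∀ M, N + 1 ≤ M →
      g x = ∑ k ∈ Finset.range M, G k x := by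
    intro N x hx M hM
    refine tsum_eq_sum fun k hk => hG0 N x hx k ?_
    rw [Finset.mem_range, not_lt] at hk
    exact hM.trans hk
  have hex : ∀ x ∈ Ω, ∃ N, x ∈ interior {x | χ N x = 1} := fun x hx => by
    obtain ⟨N, hN⟩ := hχ.exists_subset_interior {x} isCompact_singleton (by simpa using hx)
    exact ⟨N, hN rfl⟩
  have hg2 : ContDiffOn ℝ 2 g Ω := fun x hx => by
    obtain ⟨N, hN⟩ := hex x hx
    have h1 : ContDiff ℝ 2 fun x => ∑ k ∈ Finset.range (N + 1), G k x :=
      ContDiff.sum fun k _ => (hGs k).of_le (WithTop.coe_le_coe.2 (le_top : (2 : ℕ∞) ≤ ⊤))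
    refine (h1.contDiffAt.congr_of_eventuallyEq ?_).contDiffWithinAt
    filter_upwards [isOpen_interior.mem_nhds hN] with y hy
    exact hgeq N y hy _ le_rfl
  have hlim : ∀ᵐ x ∂volume.restrict Ω, Tendsto
      (fun M => ∑ k ∈ Finset.range M, (G k - fun y => layer χ k y • f y) x) atTop
      (𝓝 (g x - f x)) := by
    refine ae_restrict_of_forall_mem hΩ.measurableSet fun x hx => ?_
    obtain ⟨N, hN⟩ := hex x hx
    refine tendsto_const_nhds.congr' ?_
    filter_upwards [eventually_ge_atTop (N + 1)] with M hM
    simp only [Pi.sub_apply]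
    rw [Finset.sum_sub_distrib, ← hgeq N x hN M hM, ← Finset.sum_smul, hχ.sum_layer,
      hχ.eq_one_of_mem_interior (by omega) hN, one_smul]
  have hnorm : ∀ r : ℝ≥0∞, 1 ≤ r → (∀ k, eLpNorm (G k - fun y => layer χ k y • f y) r volume ≤
      ENNReal.ofReal (e k)) → eLpNorm (fun x => g x - f x) r (volume.restrict Ω) ≤
      ENNReal.ofReal ε := by
    intro r hr hk
    refine (eLpNorm_le_tsum_of_tendsto (fun k => ?_) hlim hr).trans ?_
    · exact ((hGs k).continuous.aestronglyMeasurable.sub (hi k).aestronglyMeasurable).restrict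
    · rw [← hesum]
      exact ENNReal.tsum_le_tsum fun k =>
        (eLpNorm_mono_measure _ Measure.restrict_le_self).trans (hk k)
  refine ⟨g, hg2, hnorm 1 le_rfl fun k => (hj k).2.1,
    hnorm _ (by simpa using hq) fun k => (hj k).2.2.1, ?_⟩
  rw [← ENNReal.ofReal_toReal hV.ne, ← ENNReal.ofReal_add ENNReal.toReal_nonneg hε.le]
  refine lintegral_enorm_gradient_le hΩ hg2 fun Φ hΦ hΦ1 => ?_
  obtain ⟨N, hN⟩ := hχ.exists_subset_interior _ hΦ.hasCompactSupport.isCompact hΦ.tsupport_subset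
  rw [setIntegral_mul_vdiv_eq_integral hΦ.tsupport_subset]
  have h1 : ∫ x, g x * vdiv n Φ x =
      ∫ x, (∑ k ∈ Finset.range (N + 1), G k x) * vdiv n Φ x := by
    refine integral_congr_ae (Eventually.of_forall fun x => ?_)
    by_cases hx : x ∈ tsupport Φ
    · simp only [hgeq N x (hN hx) _ le_rfl]
    · have : vdiv n Φ x = 0 :=
        image_eq_zero_of_notMem_tsupport fun h => hx (tsupport_vdiv_subset Φ h)
      simp only [this, mul_zero]
  rw [h1]
  refine (integral_sum_mollify_mul_vdiv_le hf hV hζ hχ.layer_nonneg (fun x => ?_)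
    (fun k => (he k).le) (fun k => (hj k).2.2.2) hΦ.contDiff hΦ.hasCompactSupport hΦ1
    fun x hx => ?_).trans ?_
  · rw [hχ.sum_layer]; exact (hχ.mem_Icc _ _).2
  · rw [← gradient_sum _ fun k _ => (hζ k).contDiff.differentiable one_ne_zero x]
    have h2 : (fun y => ∑ k ∈ Finset.range (N + 1), layer χ k y) =ᶠ[𝓝 x] fun _ => 1 := by
      filter_upwards [isOpen_interior.mem_nhds (hN hx)] with y hy
      rw [hχ.sum_layer, hχ.eq_one_of_mem_interior (Nat.le_succ _) hy]
    rw [gradient, h2.fderiv_eq]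
    simp
  · gcongr
    exact sum_le_hasSum _ (fun k _ => (he k).le) hsum

end SmoothApproximation

section Truncation

/-- A smooth bounded function approximating the identity as `k → ∞`. -/
def smoothTrunc (k : ℕ) (t : ℝ) : ℝ := k * Real.arctan (t / k)

/-- The difference of two consecutive truncations. -/
def truncSlice (k : ℕ) (t : ℝ) : ℝ := smoothTrunc (k + 1) t - smoothTrunc k t

lemma smoothTrunc_zero (t : ℝ) : smoothTrunc 0 t = 0 := by simp [smoothTrunc]

lemma smoothTrunc_apply_zero (k : ℕ) : smoothTrunc k 0 = 0 := by simp [smoothTrunc]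

lemma sum_truncSlice (N : ℕ) (t : ℝ) :
    ∑ k ∈ Finset.range N, truncSlice k t = smoothTrunc N t := by
  simp [truncSlice, Finset.sum_range_sub (fun k => smoothTrunc k t), smoothTrunc_zero]

lemma contDiff_smoothTrunc (k : ℕ) {m : WithTop ℕ∞} : ContDiff ℝ m (smoothTrunc k) :=
  contDiff_const.mul (Real.contDiff_arctan.comp (contDiff_id.div_const _))

lemma contDiff_truncSlice (k : ℕ) {m : WithTop ℕ∞} : ContDiff ℝ m (truncSlice k) :=
  (contDiff_smoothTrunc _).sub (contDiff_smoothTrunc _)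

lemma deriv_smoothTrunc (k : ℕ) (t : ℝ) :
    deriv (smoothTrunc k) t = (k : ℝ) ^ 2 / ((k : ℝ) ^ 2 + t ^ 2) := by
  have h : HasDerivAt (smoothTrunc k)
      ((k : ℝ) * (1 / (1 + (t / k) ^ 2) * (1 / k))) t :=
    (((hasDerivAt_id t).div_const (k : ℝ)).arctan).const_mul _
  rw [h.deriv]
  rcases eq_or_ne (k : ℝ) 0 with hk | hk
  · simp [hk]
  · have h1 : (k : ℝ) ^ 2 + t ^ 2 ≠ 0 := by positivity
    field_simp

lemma deriv_truncSlice (k : ℕ) (t : ℝ) :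
    deriv (truncSlice k) t = deriv (smoothTrunc (k + 1)) t - deriv (smoothTrunc k) t :=
  deriv_fun_sub ((contDiff_smoothTrunc (m := 1) _).differentiable one_ne_zero t)
    ((contDiff_smoothTrunc (m := 1) _).differentiable one_ne_zero t)

lemma deriv_smoothTrunc_nonneg (k : ℕ) (t : ℝ) : 0 ≤ deriv (smoothTrunc k) t := by
  rw [deriv_smoothTrunc]; positivity

lemma deriv_smoothTrunc_le_one (k : ℕ) (t : ℝ) : deriv (smoothTrunc k) t ≤ 1 := by
  rw [deriv_smoothTrunc]
  exact div_le_one_of_le₀ (by nlinarith) (by positivity)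

lemma deriv_truncSlice_nonneg (k : ℕ) (t : ℝ) : 0 ≤ deriv (truncSlice k) t := by
  rw [deriv_truncSlice, deriv_smoothTrunc, deriv_smoothTrunc, sub_nonneg]
  rcases Nat.eq_zero_or_pos k with rfl | hk
  · simp; positivity
  · have hk' : (0 : ℝ) < k := by exact_mod_cast hk
    rw [div_le_div_iff₀ (by positivity) (by positivity)]
    push_cast
    nlinarith [mul_nonneg (sq_nonneg t) hk'.le, sq_nonneg t]

lemma deriv_truncSlice_le_one (k : ℕ) (t : ℝ) : deriv (truncSlice k) t ≤ 1 := by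
  rw [deriv_truncSlice]
  linarith [deriv_smoothTrunc_le_one (k + 1) t, deriv_smoothTrunc_nonneg k t]

lemma sum_deriv_truncSlice_le_one (N : ℕ) (t : ℝ) :
    ∑ k ∈ Finset.range N, deriv (truncSlice k) t ≤ 1 := by
  simp_rw [deriv_truncSlice]
  rw [Finset.sum_range_sub (fun k => deriv (smoothTrunc k) t)]
  linarith [deriv_smoothTrunc_le_one N t, deriv_smoothTrunc_nonneg 0 t]

lemma tsum_ofReal_deriv_truncSlice_le_one (t : ℝ) :
    ∑' k, ENNReal.ofReal (deriv (truncSlice k) t) ≤ 1 := by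
  refine ENNReal.tsum_le_of_sum_range_le fun N => ?_
  rw [← ENNReal.ofReal_sum_of_nonneg fun k _ => deriv_truncSlice_nonneg k t]
  exact ENNReal.ofReal_le_one.2 (sum_deriv_truncSlice_le_one N t)

lemma lipschitzWith_smoothTrunc (k : ℕ) : LipschitzWith 1 (smoothTrunc k) :=
  lipschitzWith_of_nnnorm_deriv_le ((contDiff_smoothTrunc (m := 1) _).differentiable one_ne_zero)
    fun t => by
      rw [← NNReal.coe_le_coe, coe_nnnorm, Real.norm_of_nonneg (deriv_smoothTrunc_nonneg k t)]
      exact deriv_smoothTrunc_le_one k t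

lemma lipschitzWith_truncSlice (k : ℕ) : LipschitzWith 1 (truncSlice k) :=
  lipschitzWith_of_nnnorm_deriv_le ((contDiff_truncSlice (m := 1) _).differentiable one_ne_zero)
    fun t => by
      rw [← NNReal.coe_le_coe, coe_nnnorm, Real.norm_of_nonneg (deriv_truncSlice_nonneg k t)]
      exact deriv_truncSlice_le_one k t

lemma truncSlice_apply_zero (k : ℕ) : truncSlice k 0 = 0 := by
  simp [truncSlice, smoothTrunc_apply_zero]

lemma abs_smoothTrunc_le (k : ℕ) (t : ℝ) : |smoothTrunc k t| ≤ k * (Real.pi / 2) := by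
  rw [smoothTrunc, abs_mul, Nat.abs_cast]
  gcongr
  exact abs_le.2 ⟨(Real.neg_pi_div_two_lt_arctan _).le, (Real.arctan_lt_pi_div_two _).le⟩

lemma exists_abs_truncSlice_le (k : ℕ) : ∃ M, ∀ t, |truncSlice k t| ≤ M :=
  ⟨_, fun t => (abs_sub _ _).trans
    (add_le_add (abs_smoothTrunc_le (k + 1) t) (abs_smoothTrunc_le k t))⟩

lemma tendsto_smoothTrunc (t : ℝ) : Tendsto (fun k => smoothTrunc k t) atTop (𝓝 t) := by
  have h1 : HasDerivAt (fun s : ℝ => Real.arctan (t * s)) t 0 := by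
    simpa using ((hasDerivAt_id (0 : ℝ)).const_mul t).arctan
  have h2 := hasDerivAt_iff_tendsto_slope_zero.1 h1
  have h3 : Tendsto (fun k : ℕ => ((k : ℝ))⁻¹) atTop (𝓝[≠] 0) :=
    (tendsto_inv_atTop_nhdsGT_zero.comp tendsto_natCast_atTop_atTop).mono_right
      (nhdsWithin_mono _ fun x (hx : 0 < x) => hx.ne')
  refine (h2.comp h3).congr fun k => ?_
  simp [smoothTrunc, div_eq_mul_inv]

end Truncation

section Composition

lemma LipschitzWith.norm_le_of_map_zero {T : ℝ → ℝ} (hT : LipschitzWith 1 T) (h0 : T 0 = 0)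
    (t : ℝ) : ‖T t‖ ≤ ‖t‖ := by
  simpa [h0, dist_eq_norm] using hT.dist_le_mul t 0

lemma MeasureTheory.LocallyIntegrableOn.comp_lipschitz {E : Type*} [TopologicalSpace E] [MeasurableSpace E]
    {μ : Measure E} {Ω : Set E} {f : E → ℝ} (hf : LocallyIntegrableOn f Ω μ) {T : ℝ → ℝ}
    (hT : LipschitzWith 1 T) (h0 : T 0 = 0) : LocallyIntegrableOn (fun x => T (f x)) Ω μ := by
  intro x hx
  obtain ⟨s, hs, hi⟩ := hf x hx
  exact ⟨s, hs, Integrable.mono hi (hT.continuous.comp_aestronglyMeasurable hi.aestronglyMeasurable)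
    (Eventually.of_forall fun y => LipschitzWith.norm_le_of_map_zero hT h0 _)⟩

variable {n : ℕ} {Ω : Set (EuclideanSpace ℝ (Fin n))}

lemma enorm_gradient_comp {u : EuclideanSpace ℝ (Fin n) → ℝ} {T : ℝ → ℝ}
    {x : EuclideanSpace ℝ (Fin n)} (hu : DifferentiableAt ℝ u x)
    (hT : DifferentiableAt ℝ T (u x)) (h0 : 0 ≤ deriv T (u x)) :
    ‖gradient (fun y => T (u y)) x‖ₑ = ENNReal.ofReal (deriv T (u x)) * ‖gradient u x‖ₑ := by
  have h1 : fderiv ℝ (fun y => T (u y)) x = deriv T (u x) • fderiv ℝ u x :=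
    (hT.hasDerivAt.comp_hasFDerivAt x hu.hasFDerivAt).fderiv
  rw [gradient, gradient, h1, LinearIsometryEquiv.enorm_map, LinearIsometryEquiv.enorm_map,
    enorm_smul, ← ofReal_norm (deriv T (u x)), Real.norm_of_nonneg h0]

lemma tsum_liminf_le_liminf_tsum (a : ℕ → ℕ → ℝ≥0∞) :
    ∑' k, liminf (fun j => a j k) atTop ≤ liminf (fun j => ∑' k, a j k) atTop := by
  have h := lintegral_liminf_le (μ := (Measure.count : Measure ℕ)) (f := a)
    (u := atTop) fun j => measurable_of_countable _
  simpa only [lintegral_count] using h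

/-- Slicing a function by smooth truncations does not increase its variation. -/
lemma tsum_variation_truncSlice_le (hΩ : IsOpen Ω) {f : EuclideanSpace ℝ (Fin n) → ℝ}
    (hf : LocallyIntegrableOn f Ω) (hV : variation n f Ω < ⊤) :
    ∑' k, variation n (fun x => truncSlice k (f x)) Ω ≤ variation n f Ω := by
  have hε : ∀ j : ℕ, (0 : ℝ) < 1 / ((j : ℝ) + 1) := fun j => by positivity
  choose u hu hu1 _ hu3 using fun j : ℕ =>
    exists_smooth_approx hΩ hf hV le_rfl (Or.inl rfl) (hε j)
  have hlim0 : Tendsto (fun j : ℕ => ENNReal.ofReal (1 / ((j : ℝ) + 1))) atTop (𝓝 0) := by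
    simpa using ENNReal.tendsto_ofReal tendsto_one_div_add_atTop_nhds_zero_nat
  have hu1' : ∀ j, ContDiffOn ℝ 1 (u j) Ω := fun j => (hu j).of_le (by norm_num)
  have hul : ∀ j, LocallyIntegrableOn (u j) Ω := fun j =>
    (hu j).continuousOn.locallyIntegrableOn hΩ.measurableSet
  set a : ℕ → ℕ → ℝ≥0∞ := fun j k =>
    ∫⁻ x in Ω, ENNReal.ofReal (deriv (truncSlice k) (u j x)) * ‖gradient (u j) x‖ₑ with ha
  have hvk : ∀ k, variation n (fun x => truncSlice k (f x)) Ω ≤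
      liminf (fun j => a j k) atTop := by
    intro k
    have hC : ∀ j, ContDiffOn ℝ 1 (fun x => truncSlice k (u j x)) Ω := fun j =>
      (contDiff_truncSlice k).comp_contDiffOn (hu1' j)
    have h1 := variation_le_liminf (hf.comp_lipschitz (lipschitzWith_truncSlice k)
      (truncSlice_apply_zero k))
      (fun j => (hul j).comp_lipschitz (lipschitzWith_truncSlice k) (truncSlice_apply_zero k))
      (fun j => (continuousOn_gradient hΩ (hC j)).locallyIntegrableOn hΩ.measurableSet)
      (fun j => hasWeakGradientOn_gradient hΩ (hC j)) ?_
    · refine h1.trans_eq ?_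
      congr 1
      ext j
      refine setLIntegral_congr_fun hΩ.measurableSet fun x hx => ?_
      exact enorm_gradient_comp
        (((hu1' j).contDiffAt (hΩ.mem_nhds hx)).differentiableAt one_ne_zero)
        ((contDiff_truncSlice (m := 1) k).differentiable one_ne_zero _)
        (deriv_truncSlice_nonneg k _)
    · refine tendsto_of_tendsto_of_tendsto_of_le_of_le tendsto_const_nhds hlim0
        (fun _ => zero_le) fun j => le_trans ?_ (hu1 j)
      refine eLpNorm_mono fun x => ?_
      simpa [dist_eq_norm] using (lipschitzWith_truncSlice k).dist_le_mul (u j x) (f x)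
  refine (ENNReal.tsum_le_tsum hvk).trans ((tsum_liminf_le_liminf_tsum a).trans ?_)
  have hlim : Tendsto (fun j : ℕ => variation n f Ω + ENNReal.ofReal (1 / ((j : ℝ) + 1))) atTop
      (𝓝 (variation n f Ω)) := by
    simpa using tendsto_const_nhds.add hlim0
  rw [← hlim.liminf_eq]
  refine liminf_le_liminf (Eventually.of_forall fun j => le_trans ?_ (hu3 j))
  have hθ : ∀ k, Continuous (deriv (truncSlice k)) := fun k =>
    (contDiff_truncSlice (m := 1) k).continuous_deriv le_rfl
  rw [ha, ← lintegral_tsum fun k => ?_]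
  · refine lintegral_mono fun x => ?_
    simp only
    rw [ENNReal.tsum_mul_right]
    exact mul_le_of_le_one_left zero_le (tsum_ofReal_deriv_truncSlice_le_one _)
  · refine AEMeasurable.fun_mul ?_ ?_
    · exact (((hθ k).comp_continuousOn (hu j).continuousOn).aemeasurable
        hΩ.measurableSet).ennreal_ofReal
    · exact ((continuousOn_gradient hΩ (hu1' j)).aestronglyMeasurable hΩ.measurableSet).enorm

end Composition

section Series

lemma summable_of_tsum_enorm_ne_top {E : Type*} [NormedAddCommGroup E] [CompleteSpace E]
    {a : ℕ → E} (h : ∑' k, ‖a k‖ₑ ≠ ⊤) : Summable a :=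
  .of_nnnorm (ENNReal.tsum_coe_ne_top_iff_summable.1 h)

variable {α E : Type*} [MeasurableSpace α] {μ : Measure α} [NormedAddCommGroup E]
  [CompleteSpace E] {h : ℕ → α → E}

lemma ae_summable_of_tsum_lintegral_ne_top (hm : ∀ k, AEStronglyMeasurable (h k) μ)
    (hs : ∑' k, ∫⁻ x, ‖h k x‖ₑ ∂μ ≠ ⊤) : ∀ᵐ x ∂μ, Summable fun k => h k x := by
  rw [← lintegral_tsum fun k => (hm k).enorm] at hs
  filter_upwards [ae_lt_top' (AEMeasurable.tsum fun k => (hm k).enorm) hs] with x hx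
  exact summable_of_tsum_enorm_ne_top hx.ne

lemma integrable_tsum_of_tsum_lintegral_ne_top (hm : ∀ k, AEStronglyMeasurable (h k) μ)
    (hs : ∑' k, ∫⁻ x, ‖h k x‖ₑ ∂μ ≠ ⊤) : Integrable (fun x => ∑' k, h k x) μ := by
  refine ⟨aestronglyMeasurable_of_tendsto_ae atTop
    (f := fun N x => ∑ k ∈ Finset.range N, h k x)
    (fun N => Finset.aestronglyMeasurable_fun_sum _ fun k _ => hm k) ?_, ?_⟩
  · filter_upwards [ae_summable_of_tsum_lintegral_ne_top hm hs] with x hx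
    exact hx.hasSum.tendsto_sum_nat
  · rw [← lintegral_tsum fun k => (hm k).enorm] at hs
    exact (lintegral_mono fun x => enorm_tsum_le_tsum_enorm).trans_lt hs.lt_top

lemma hasSum_integral_of_tsum_lintegral_ne_top [NormedSpace ℝ E]
    (hm : ∀ k, AEStronglyMeasurable (h k) μ) (hs : ∑' k, ∫⁻ x, ‖h k x‖ₑ ∂μ ≠ ⊤) :
    HasSum (fun k => ∫ x, h k x ∂μ) (∫ x, ∑' k, h k x ∂μ) := by
  rw [integral_tsum hm hs]
  refine (summable_of_tsum_enorm_ne_top (ne_top_of_le_ne_top hs ?_)).hasSum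
  exact ENNReal.tsum_le_tsum fun k => enorm_integral_le_lintegral_enorm _

lemma tsum_lintegral_mul_ne_top {u : ℕ → α → ℝ} {v : α → ℝ} {C : ℝ} (hC : ∀ x, ‖v x‖ ≤ C)
    (hs : ∑' k, ∫⁻ x, ‖u k x‖ₑ ∂μ ≠ ⊤) : ∑' k, ∫⁻ x, ‖u k x * v x‖ₑ ∂μ ≠ ⊤ := by
  refine ne_top_of_le_ne_top (ENNReal.mul_ne_top hs (ENNReal.ofReal_ne_top (r := C))) ?_
  rw [← ENNReal.tsum_mul_right]
  refine ENNReal.tsum_le_tsum fun k => ?_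
  rw [← lintegral_mul_const' _ _ ENNReal.ofReal_ne_top]
  refine lintegral_mono fun x => ?_
  rw [enorm_mul, ← ofReal_norm (v x)]
  gcongr
  exact hC x

end Series

section Reassembly

variable {n : ℕ} {Ω : Set (EuclideanSpace ℝ (Fin n))}

lemma tendsto_integral_smoothTrunc_mul {α : Type*} [MeasurableSpace α] {μ : Measure α}
    {f ψ : α → ℝ} (hψ : AEStronglyMeasurable ψ μ) (hf : AEStronglyMeasurable f μ)
    (hi : Integrable (fun x => f x * ψ x) μ) :
    Tendsto (fun N => ∫ x, smoothTrunc N (f x) * ψ x ∂μ) atTop (𝓝 (∫ x, f x * ψ x ∂μ)) := by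
  refine tendsto_integral_of_dominated_convergence (fun x => ‖f x * ψ x‖) (fun N => ?_) hi.norm
    (fun N => ?_) ?_
  · exact ((lipschitzWith_smoothTrunc N).continuous.comp_aestronglyMeasurable hf).mul hψ
  · refine Eventually.of_forall fun x => ?_
    rw [norm_mul, norm_mul]
    gcongr
    exact (lipschitzWith_smoothTrunc N).norm_le_of_map_zero (smoothTrunc_apply_zero N) _
  · exact Eventually.of_forall fun x => (tendsto_smoothTrunc (f x)).mul_const _

/-- Approximations of the slices `truncSlice k ∘ f` can be summed up to a weakly differentiable
approximation of `f`. -/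
lemma hasWeakGradientOn_add_tsum {f : EuclideanSpace ℝ (Fin n) → ℝ}
    (hf : LocallyIntegrableOn f Ω) {g : ℕ → EuclideanSpace ℝ (Fin n) → ℝ}
    {V : ℕ → EuclideanSpace ℝ (Fin n) → EuclideanSpace ℝ (Fin n)}
    (hg : ∀ k, LocallyIntegrableOn (g k) Ω)
    (hV : ∀ k, AEStronglyMeasurable (V k) (volume.restrict Ω))
    (hw : ∀ k, HasWeakGradientOn n (g k) (V k) Ω)
    (h1 : ∑' k, ∫⁻ x in Ω, ‖g k x - truncSlice k (f x)‖ₑ ≠ ⊤)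
    (h2 : ∑' k, ∫⁻ x in Ω, ‖V k x‖ₑ ≠ ⊤) :
    HasWeakGradientOn n (fun x => f x + ∑' k, (g k x - truncSlice k (f x)))
      (fun x => ∑' k, V k x) Ω := by
  intro φ hφ hc hs i
  set ψ : EuclideanSpace ℝ (Fin n) → ℝ := fun x => fderiv ℝ φ x (EuclideanSpace.single i 1)
    with hψ
  have hψc : Continuous ψ := (hφ.continuous_fderiv one_ne_zero).clm_apply continuous_const
  have hψcs : HasCompactSupport ψ := hc.fderiv_apply ℝ _
  have hψs : tsupport ψ ⊆ Ω := (tsupport_fderiv_apply_subset ℝ _).trans hs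
  obtain ⟨C, hC⟩ := hψcs.exists_bound_of_continuous hψc
  obtain ⟨D, hD⟩ := hc.exists_bound_of_continuous hφ.continuous
  have hsl : ∀ k, LocallyIntegrableOn (fun x => truncSlice k (f x)) Ω := fun k =>
    hf.comp_lipschitz (lipschitzWith_truncSlice k) (truncSlice_apply_zero k)
  set h : ℕ → EuclideanSpace ℝ (Fin n) → ℝ := fun k x => g k x - truncSlice k (f x) with hh
  have hhm : ∀ k, AEStronglyMeasurable (h k) (volume.restrict Ω) := fun k =>
    (hg k).aestronglyMeasurable.sub (hsl k).aestronglyMeasurable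
  have hH : Integrable (fun x => ∑' k, h k x) (volume.restrict Ω) :=
    integrable_tsum_of_tsum_lintegral_ne_top hhm h1
  have hfi : Integrable (fun x => f x * ψ x) :=
    LocallyIntegrableOn.integrable_mul hf hψc hψcs hψs
  have hHi : Integrable (fun x => (∑' k, h k x) * ψ x) :=
    LocallyIntegrableOn.integrable_mul (IntegrableOn.locallyIntegrableOn hH) hψc hψcs hψs
  have t1 : Tendsto (fun N => ∑ k ∈ Finset.range N, ∫ x in Ω, truncSlice k (f x) * ψ x) atTop
      (𝓝 (∫ x in Ω, f x * ψ x)) := by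
    refine (tendsto_integral_smoothTrunc_mul hψc.aestronglyMeasurable hf.aestronglyMeasurable
      hfi.restrict).congr fun N => ?_
    rw [← integral_finsetSum]
    · simp_rw [← sum_truncSlice N, Finset.sum_mul]
    · exact fun k _ => (LocallyIntegrableOn.integrable_mul (hsl k) hψc hψcs hψs).restrict
  have t2 : Tendsto (fun N => ∑ k ∈ Finset.range N, ∫ x in Ω, h k x * ψ x) atTop
      (𝓝 (∫ x in Ω, (∑' k, h k x) * ψ x)) := by
    have := (hasSum_integral_of_tsum_lintegral_ne_top (fun k => (hhm k).fun_mul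
      hψc.aestronglyMeasurable) (tsum_lintegral_mul_ne_top hC h1)).tendsto_sum_nat
    simpa only [tsum_mul_right] using this
  have hVm : ∀ k, AEStronglyMeasurable (fun x => V k x i) (volume.restrict Ω) := fun k =>
    (EuclideanSpace.proj (𝕜 := ℝ) i).continuous.comp_aestronglyMeasurable (hV k)
  have hVs : ∑' k, ∫⁻ x in Ω, ‖V k x i‖ₑ ≠ ⊤ := by
    refine ne_top_of_le_ne_top h2 (ENNReal.tsum_le_tsum fun k => lintegral_mono fun x => ?_)
    exact enorm_le_iff_norm_le.2 (PiLp.norm_apply_le (V k x) i)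
  have t3 : Tendsto (fun N => ∑ k ∈ Finset.range N, ∫ x in Ω, V k x i * φ x) atTop
      (𝓝 (∫ x in Ω, (∑' k, V k x i) * φ x)) := by
    have := (hasSum_integral_of_tsum_lintegral_ne_top (fun k => (hVm k).fun_mul
      hφ.continuous.aestronglyMeasurable) (tsum_lintegral_mul_ne_top hD hVs)).tendsto_sum_nat
    simpa only [tsum_mul_right] using this
  have key : ∀ k, (∫ x in Ω, truncSlice k (f x) * ψ x) + (∫ x in Ω, h k x * ψ x) =
      -∫ x in Ω, V k x i * φ x := by
    intro k
    have hgi : Integrable (fun x => g k x * ψ x) :=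
      LocallyIntegrableOn.integrable_mul (hg k) hψc hψcs hψs
    have hti := LocallyIntegrableOn.integrable_mul (hsl k) hψc hψcs hψs
    have e : (∫ x in Ω, h k x * ψ x) =
        (∫ x in Ω, g k x * ψ x) - ∫ x in Ω, truncSlice k (f x) * ψ x := by
      rw [← integral_sub hgi.restrict hti.restrict]
      simp only [hh, sub_mul]
    rw [e, add_sub_cancel, hw k φ hφ hc hs i]
    simp only [mul_comm]
  have hu := tendsto_nhds_unique ((t1.add t2).congr fun N => by
    rw [← Finset.sum_add_distrib, Finset.sum_congr rfl fun k _ => key k,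
      Finset.sum_neg_distrib]) t3.neg
  calc ∫ x in Ω, (f x + ∑' k, h k x) * ψ x
      = (∫ x in Ω, f x * ψ x) + ∫ x in Ω, (∑' k, h k x) * ψ x := by
        rw [← integral_add hfi.restrict hHi.restrict]
        simp only [add_mul]
    _ = -∫ x in Ω, (∑' k, V k x i) * φ x := hu
    _ = -∫ x in Ω, φ x * (∑' k, V k x) i := by
        congr 1
        refine integral_congr_ae ?_
        filter_upwards [ae_summable_of_tsum_lintegral_ne_top hV h2] with x hx
        have := (EuclideanSpace.proj (𝕜 := ℝ) i).map_tsum hx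
        simp only [PiLp.proj_apply] at this
        rw [this, mul_comm]

/-- Approximation of `f` up to an error `ε` in `L¹ ∩ L^p` and in variation. -/
lemma exists_weakGradient_approx (hΩ : IsOpen Ω) {f : EuclideanSpace ℝ (Fin n) → ℝ}
    (hf : LocallyIntegrableOn f Ω) (hvar : variation n f Ω < ⊤) {p : ℝ} (hp : 1 ≤ p) {ε : ℝ}
    (hε : 0 < ε) :
    ∃ (F : EuclideanSpace ℝ (Fin n) → ℝ)
      (G : EuclideanSpace ℝ (Fin n) → EuclideanSpace ℝ (Fin n)),
      LocallyIntegrableOn F Ω ∧ IntegrableOn G Ω ∧ HasWeakGradientOn n F G Ω ∧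
      eLpNorm (fun x => F x - f x) 1 (volume.restrict Ω) ≤ ENNReal.ofReal ε ∧
      eLpNorm (fun x => F x - f x) (ENNReal.ofReal p) (volume.restrict Ω) ≤ ENNReal.ofReal ε ∧
      ∫⁻ x in Ω, ‖G x‖ₑ ≤ variation n f Ω + ENNReal.ofReal ε := by
  have hsl : ∀ k, LocallyIntegrableOn (fun x => truncSlice k (f x)) Ω := fun k =>
    hf.comp_lipschitz (lipschitzWith_truncSlice k) (truncSlice_apply_zero k)
  have hsv := tsum_variation_truncSlice_le hΩ hf hvar
  have hδ : ∀ k : ℕ, 0 < ε / 2 / 2 ^ k := fun k => by positivity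
  have hδs : ∑' k : ℕ, ENNReal.ofReal (ε / 2 / 2 ^ k) = ENNReal.ofReal ε := by
    rw [← ENNReal.ofReal_tsum_of_nonneg (fun k => (hδ k).le) (hasSum_geometric_two' ε).summable,
      (hasSum_geometric_two' ε).tsum_eq]
  choose g hg g1 g2 g3 using fun k : ℕ => exists_smooth_approx hΩ (hsl k)
    ((ENNReal.le_tsum k).trans_lt (hsv.trans_lt hvar)) hp
    (Or.inr ((exists_abs_truncSlice_le k).imp fun M hM x => hM (f x))) (hδ k)
  have hgC : ∀ k, ContDiffOn ℝ 1 (g k) Ω := fun k => (hg k).of_le (by norm_num)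
  have hgl : ∀ k, LocallyIntegrableOn (g k) Ω := fun k =>
    (hg k).continuousOn.locallyIntegrableOn hΩ.measurableSet
  have hVm : ∀ k, AEStronglyMeasurable (gradient (g k)) (volume.restrict Ω) := fun k =>
    (continuousOn_gradient hΩ (hgC k)).aestronglyMeasurable hΩ.measurableSet
  have hhm : ∀ k, AEStronglyMeasurable (fun x => g k x - truncSlice k (f x))
      (volume.restrict Ω) := fun k =>
    (hgl k).aestronglyMeasurable.sub (hsl k).aestronglyMeasurable
  have h1 : ∑' k, ∫⁻ x in Ω, ‖g k x - truncSlice k (f x)‖ₑ ≠ ⊤ := by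
    refine ne_top_of_le_ne_top (ENNReal.ofReal_ne_top (r := ε)) (hδs ▸ ?_)
    refine ENNReal.tsum_le_tsum fun k => ?_
    rw [← eLpNorm_one_eq_lintegral_enorm]
    exact g1 k
  have h2 : ∑' k, ∫⁻ x in Ω, ‖gradient (g k) x‖ₑ ≤ variation n f Ω + ENNReal.ofReal ε := by
    refine (ENNReal.tsum_le_tsum g3).trans ?_
    rw [ENNReal.tsum_add, hδs]
    gcongr
  have h2' : ∑' k, ∫⁻ x in Ω, ‖gradient (g k) x‖ₑ ≠ ⊤ :=
    ne_top_of_le_ne_top (ENNReal.add_ne_top.2 ⟨hvar.ne, ENNReal.ofReal_ne_top⟩) h2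
  have hlim : ∀ᵐ x ∂(volume.restrict Ω), Tendsto
      (fun N => ∑ k ∈ Finset.range N, (g k x - truncSlice k (f x))) atTop
      (𝓝 ((f x + ∑' k, (g k x - truncSlice k (f x))) - f x)) := by
    filter_upwards [ae_summable_of_tsum_lintegral_ne_top hhm h1] with x hx
    simpa using hx.hasSum.tendsto_sum_nat
  refine ⟨fun x => f x + ∑' k, (g k x - truncSlice k (f x)), fun x => ∑' k, gradient (g k) x,
    hf.add (IntegrableOn.locallyIntegrableOn (integrable_tsum_of_tsum_lintegral_ne_top hhm h1)),
    integrable_tsum_of_tsum_lintegral_ne_top hVm h2',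
    hasWeakGradientOn_add_tsum hf hgl hVm
      (fun k => hasWeakGradientOn_gradient hΩ (hgC k)) h1 h2', ?_, ?_, ?_⟩
  · refine (eLpNorm_le_tsum_of_tendsto hhm hlim le_rfl).trans ?_
    exact hδs ▸ ENNReal.tsum_le_tsum g1
  · refine (eLpNorm_le_tsum_of_tendsto hhm hlim (ENNReal.one_le_ofReal.2 hp)).trans ?_
    exact hδs ▸ ENNReal.tsum_le_tsum g2
  · refine (lintegral_mono fun x => enorm_tsum_le_tsum_enorm).trans ?_
    rwa [lintegral_tsum fun k => (hVm k).enorm]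

end Reassembly

/-- Approximation of a function of bounded variation by
`W^{1,1}_loc` functions in the `L¹ ∩ L^p` norm, with convergence of the
total variations. -/
theorem BV_approximation_W11loc_Lp
    (n : ℕ) (hn : 1 ≤ n)
    (Ω : Set (EuclideanSpace ℝ (Fin n))) (hΩ : IsOpen Ω)
    (p : ℝ) (hp : 1 ≤ p)
    (f : EuclideanSpace ℝ (Fin n) → ℝ) (hf : LocallyIntegrableOn f Ω volume)
    (hvar : variation n f Ω < ⊤) :
    ∃ (F : ℕ → EuclideanSpace ℝ (Fin n) → ℝ)
      (G : ℕ → EuclideanSpace ℝ (Fin n) → EuclideanSpace ℝ (Fin n)),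
      (∀ i, LocallyIntegrableOn (F i) Ω volume) ∧
      (∀ i, LocallyIntegrableOn (G i) Ω volume) ∧
      (∀ i, HasWeakGradientOn n (F i) (G i) Ω) ∧
      (∀ i, eLpNorm (fun x => F i x - f x) 1 (volume.restrict Ω) < ⊤) ∧
      (∀ i, eLpNorm (fun x => F i x - f x) (ENNReal.ofReal p)
        (volume.restrict Ω) < ⊤) ∧
      Tendsto (fun i => eLpNorm (fun x => F i x - f x) 1 (volume.restrict Ω))
        atTop (𝓝 0) ∧
      Tendsto (fun i => eLpNorm (fun x => F i x - f x) (ENNReal.ofReal p)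
        (volume.restrict Ω)) atTop (𝓝 0) ∧
      (∀ i, IntegrableOn (fun x => ‖G i x‖) Ω volume) ∧
      Tendsto (fun i => ENNReal.ofReal (∫ x in Ω, ‖G i x‖)) atTop
        (𝓝 (variation n f Ω)) := by
  have hε : ∀ i : ℕ, (0 : ℝ) < 1 / ((i : ℝ) + 1) := fun i => by positivity
  choose F G hF hG hw h1 h2 h3 using fun i : ℕ =>
    exists_weakGradient_approx hΩ hf hvar hp (hε i)
  have hlim0 : Tendsto (fun j : ℕ => ENNReal.ofReal (1 / ((j : ℝ) + 1))) atTop (𝓝 0) := by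
    simpa using ENNReal.tendsto_ofReal tendsto_one_div_add_atTop_nhds_zero_nat
  have ht1 : Tendsto (fun i => eLpNorm (fun x => F i x - f x) 1 (volume.restrict Ω))
      atTop (𝓝 0) :=
    tendsto_of_tendsto_of_tendsto_of_le_of_le tendsto_const_nhds hlim0 (fun _ => zero_le) h1
  refine ⟨F, G, hF, fun i => (hG i).locallyIntegrableOn, hw,
    fun i => (h1 i).trans_lt ENNReal.ofReal_lt_top,
    fun i => (h2 i).trans_lt ENNReal.ofReal_lt_top, ht1,
    tendsto_of_tendsto_of_tendsto_of_le_of_le tendsto_const_nhds hlim0 (fun _ => zero_le) h2,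
    fun i => (hG i).norm, ?_⟩
  simp_rw [fun i => ofReal_integral_norm_eq_lintegral_enorm (hG i)]
  have hlim : Tendsto (fun j : ℕ => variation n f Ω + ENNReal.ofReal (1 / ((j : ℝ) + 1))) atTop
      (𝓝 (variation n f Ω)) := by
    simpa using tendsto_const_nhds.add hlim0
  refine tendsto_of_le_liminf_of_limsup_le
    (variation_le_liminf hf hF (fun i => (hG i).locallyIntegrableOn) hw ht1) ?_
  rw [← hlim.limsup_eq]
  exact limsup_le_limsup (Eventually.of_forall h3)

end
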